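/- Let λ > 1. There exists a constant C > 0 depending only on λ such that: if f : S² → ℝ satisfies 1/λ < f < λ and K ⊂ ℝ³ is a convex body containing the origin in its closure that solves the logarithmic Minkowski problem with density f (h_K dS_K = f dH²), then ‖h_K‖_{L∞(S²)} ≤ C; equivalently, K ⊂ B_C(o). -/

import Mathlib

open MeasureTheory Metric Set Filter
open scoped RealInnerProductSpace ENNReal NNReal Real

noncomputable section

abbrev E3 := EuclideanSpace ℝ (Fin 3)

def unitSphere : Set E3 := Metric.sphere 0 1

def IsConvexBody (K : Set E3) : Prop :=
  Convex ℝ K ∧ IsCompact K ∧ (interior K).Nonempty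

def suppFn (K : Set E3) (x : E3) : ℝ := sSup ((fun y => ⟪x, y⟫) '' K)

def outerNormalAt (K : Set E3) (x ν : E3) : Prop :=
  ‖ν‖ = 1 ∧ ∀ z ∈ K, ⟪ν, z - x⟫ ≤ (0:ℝ)

def gaussPre (K : Set E3) (ω : Set E3) : Set E3 :=
  {x ∈ frontier K | ∃ ν ∈ ω, outerNormalAt K x ν}

def coneOver (G : Set E3) : Set E3 := {y | ∃ x ∈ G, ∃ t ∈ Set.Icc (0:ℝ) 1, y = t • x}

def SolvesLMP (K : Set E3) (f : E3 → ℝ) : Prop :=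
  ∀ ω : Set E3, ω ⊆ unitSphere → MeasurableSet ω →
    3 * (volume (coneOver (gaussPre K ω))).toReal = ∫ u in ω, f u ∂(μH[2])

def sphSupNorm (f : E3 → ℝ) : ℝ := sSup {c | ∃ x ∈ unitSphere, c = |f x|}

def sphHolderSemi (α : ℝ) (f : E3 → ℝ) : ℝ :=
  sSup {c | ∃ x ∈ unitSphere, ∃ y ∈ unitSphere, x ≠ y ∧ c = |f x - f y| / ‖x - y‖ ^ α}

def sphHolderNorm (α : ℝ) (f : E3 → ℝ) : ℝ := sphSupNorm f + sphHolderSemi α f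

/-! ### Part 1: Hausdorff measure on the sphere -/

lemma e3_norm_sq (u : E3) : ‖u‖ ^ 2 = u 0 ^ 2 + u 1 ^ 2 + u 2 ^ 2 := by
  rw [EuclideanSpace.norm_sq_eq]
  simp [Fin.sum_univ_three]

lemma e3_inner (u v : E3) : ⟪u, v⟫ = u 0 * v 0 + u 1 * v 1 + u 2 * v 2 := by
  simp [PiLp.inner_apply, Fin.sum_univ_three]
  ring

lemma mem_unitSphere (u : E3) : u ∈ unitSphere ↔ u 0 ^ 2 + u 1 ^ 2 + u 2 ^ 2 = 1 := by
  rw [← e3_norm_sq, unitSphere, mem_sphere_zero_iff_norm]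
  constructor
  · intro h; rw [h]; norm_num
  · intro h
    have := norm_nonneg u
    nlinarith

lemma measurableSet_unitSphere : MeasurableSet unitSphere :=
  Metric.isClosed_sphere.measurableSet

def band (δ : ℝ) : Set E3 := {u | u ∈ unitSphere ∧ |u 2| ≤ δ}

lemma measurableSet_band (δ : ℝ) : MeasurableSet (band δ) := by
  have h : IsClosed {u : E3 | |u 2| ≤ δ} := isClosed_le (by fun_prop) continuous_const
  exact measurableSet_unitSphere.inter h.measurableSet

lemma circle_null : μH[2] (band 0) = 0 := by
  let g : ℝ → E3 := fun θ => !₂[Real.cos θ, Real.sin θ, 0]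
  have hg : ContDiff ℝ 1 g := by
    rw [contDiff_euclidean]
    intro i
    fin_cases i
    · exact Real.contDiff_cos
    · exact Real.contDiff_sin
    · exact contDiff_const
  have hd := hg.dimH_range_le
  have hlt : dimH (range g) < (2 : ℝ≥0) := by
    refine lt_of_le_of_lt hd ?_
    simp
  have h0 := hausdorffMeasure_of_dimH_lt hlt
  refine measure_mono_null ?_ (by simpa using h0)
  rintro u ⟨hu, hu2⟩
  rw [mem_unitSphere] at hu
  have h2 : u 2 = 0 := by simpa using hu2
  rw [h2] at hu
  have hc : ∃ θ : ℝ, Real.cos θ = u 0 ∧ Real.sin θ = u 1 := by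
    let z : ℂ := ⟨u 0, u 1⟩
    have hz : ‖z‖ = 1 := by
      have : ‖z‖ ^ 2 = 1 := by
        rw [← Complex.normSq_eq_norm_sq, Complex.normSq_apply]
        simp only [z]; nlinarith
      have h3 := norm_nonneg z
      nlinarith
    refine ⟨Complex.arg z, ?_, ?_⟩
    · rw [Complex.cos_arg]
      · simp [hz, z]
      · intro h; rw [h] at hz; simp at hz
    · rw [Complex.sin_arg]; simp [hz, z]
  obtain ⟨θ, h1, h3⟩ := hc
  refine ⟨θ, ?_⟩
  ext i
  fin_cases i
  · simpa [g] using h1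
  · simpa [g] using h3
  · simpa [g] using h2.symm

lemma exists_band (hfin : μH[2] unitSphere ≠ ∞) {ε : ℝ} (hε : 0 < ε) :
    ∃ δ > 0, (μH[2] (band δ)).toReal ≤ ε := by
  have hI : (⋂ n : ℕ, band (1 / (n + 1))) = band 0 := by
    ext u
    simp only [mem_iInter, band, mem_ofPred_eq]
    constructor
    · intro h
      refine ⟨(h 0).1, ?_⟩
      refine le_of_forall_pos_le_add ?_
      intro e he
      obtain ⟨n, hn⟩ := exists_nat_one_div_lt he
      have := (h n).2
      linarith
    · intro h n
      exact ⟨h.1, h.2.trans (by positivity)⟩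
  have ht : Tendsto (fun n : ℕ => μH[2] (band (1 / ((n : ℝ) + 1)))) atTop (nhds (μH[2] (band 0))) := by
    rw [← hI]
    apply tendsto_measure_iInter_atTop
    · intro n; exact (measurableSet_band _).nullMeasurableSet
    · intro m n hmn u hu
      refine ⟨hu.1, hu.2.trans ?_⟩
      apply one_div_le_one_div_of_le
      · positivity
      · have : (m : ℝ) ≤ n := by exact_mod_cast hmn
        linarith
    · exact ⟨0, ne_top_of_le_ne_top hfin (measure_mono (fun u hu => hu.1))⟩
  rw [circle_null] at ht
  have := (ht.eventually (gt_mem_nhds (ENNReal.ofReal_pos.2 hε))).exists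
  obtain ⟨n, hn⟩ := this
  refine ⟨1 / ((n : ℝ) + 1), by positivity, ?_⟩
  exact ENNReal.toReal_le_of_le_ofReal hε.le hn.le

/-- The piece of the sphere used for lower bounds. -/
def strip (c s σ : ℝ) : Set E3 :=
  {u | u ∈ unitSphere ∧ |u 0| ≤ 1 / 2 ∧ |-s * u 1 + c * u 2| ≤ σ ∧ c * u 1 + s * u 2 ≤ 0}

lemma measurableSet_strip (c s σ : ℝ) : MeasurableSet (strip c s σ) := by
  have h1 : IsClosed {u : E3 | |u 0| ≤ 1 / 2} := isClosed_le (by fun_prop) continuous_const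
  have h2 : IsClosed {u : E3 | |-s * u 1 + c * u 2| ≤ σ} :=
    isClosed_le (by fun_prop) continuous_const
  have h3 : IsClosed {u : E3 | c * u 1 + s * u 2 ≤ 0} :=
    isClosed_le (by fun_prop) continuous_const
  exact measurableSet_unitSphere.inter (h1.inter (h2.inter h3)).measurableSet

lemma strip_lower (hfin : μH[2] unitSphere ≠ ∞) {c s σ : ℝ} (hcs : c ^ 2 + s ^ 2 = 1)
    (hσ : 0 < σ) (hσ2 : σ ≤ 1 / 2) : 2 * σ ≤ (μH[2] (strip c s σ)).toReal := by
  let P : E3 → (Fin 2 → ℝ) := fun u => ![u 0, -s * u 1 + c * u 2]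
  have hP : LipschitzWith 1 P := by
    apply LipschitzWith.of_dist_le_mul
    intro x y
    rw [NNReal.coe_one, one_mul, dist_pi_le_iff dist_nonneg]
    have key := e3_norm_sq (x - y)
    rw [← dist_eq_norm] at key
    simp only [PiLp.sub_apply] at key
    intro i
    have hd : 0 ≤ dist x y := dist_nonneg
    fin_cases i
    · simp only [P, Real.dist_eq]
      apply abs_le_of_sq_le_sq _ hd
      rw [key]
      simp
      nlinarith [sq_nonneg (x 1 - y 1), sq_nonneg (x 2 - y 2)]
    · simp only [P, Real.dist_eq]
      apply abs_le_of_sq_le_sq _ hd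
      rw [key]
      simp
      have h1 : (-(s * x 1) + c * x 2 - (-(s * y 1) + c * y 2)) ^ 2 +
        (c * (x 1 - y 1) + s * (x 2 - y 2)) ^ 2 = (c ^ 2 + s ^ 2) * ((x 1 - y 1) ^ 2 + (x 2 - y 2) ^ 2) := by ring
      rw [hcs] at h1
      nlinarith [sq_nonneg (c * (x 1 - y 1) + s * (x 2 - y 2)), sq_nonneg (x 0 - y 0)]
  have h1 := hP.hausdorffMeasure_image_le (d := 2) (by norm_num) (strip c s σ)
  have hsub : Icc ![-(1 / 2 : ℝ), -σ] ![1 / 2, σ] ⊆ P '' strip c s σ := by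
    intro z hz
    have hz0 := hz.1 0
    have hz1 := hz.1 1
    have hz2 := hz.2 0
    have hz3 := hz.2 1
    simp at hz0 hz1 hz2 hz3
    set k : ℝ := Real.sqrt (1 - z 0 ^ 2 - z 1 ^ 2) with hk
    have hk2 : k ^ 2 = 1 - z 0 ^ 2 - z 1 ^ 2 := by
      apply Real.sq_sqrt
      nlinarith
    have hk0 : 0 ≤ k := Real.sqrt_nonneg _
    refine ⟨!₂[z 0, -c * k - s * z 1, -s * k + c * z 1], ⟨?_, ?_, ?_, ?_⟩, ?_⟩
    · rw [mem_unitSphere]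
      simp
      have : z 0 ^ 2 + (-(c * k) - s * z 1) ^ 2 + (-(s * k) + c * z 1) ^ 2 = z 0 ^ 2 + (c ^ 2 + s ^ 2) * (k ^ 2 + z 1 ^ 2) := by ring
      rw [this, hcs, hk2]; ring
    · simp [abs_le]; constructor <;> linarith
    · simp
      have : -(s * (-(c * k) - s * z 1)) + c * (-(s * k) + c * z 1) = (c ^ 2 + s ^ 2) * z 1 := by ring
      rw [this, hcs, abs_le]; constructor <;> linarith
    · simp
      have : c * (-(c * k) - s * z 1) + s * (-(s * k) + c * z 1) = - ((c ^ 2 + s ^ 2) * k) := by ring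
      rw [this, hcs]; linarith
    · ext i
      fin_cases i
      · simp [P]
      · simp [P]
        have : -(s * (-(c * k) - s * z 1)) + c * (-(s * k) + c * z 1) = (c ^ 2 + s ^ 2) * z 1 := by ring
        rw [this, hcs]; ring
  have h2 : (μH[2] : Measure (Fin 2 → ℝ)) = volume := by
    have := hausdorffMeasure_pi_real (ι := Fin 2)
    simpa using this
  have h3 := measure_mono (μ := (μH[2] : Measure (Fin 2 → ℝ))) hsub
  have h4 := h3.trans h1
  rw [h2, Real.volume_Icc_pi] at h4
  simp at h4
  rw [← ENNReal.ofReal_mul (by norm_num)] at h4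
  have hf : μH[2] (strip c s σ) ≠ ∞ := ne_top_of_le_ne_top hfin (measure_mono (fun u hu => hu.1))
  have h5 := (ENNReal.ofReal_le_iff_le_toReal hf).1 h4
  linarith
/-! ### Part 2: volumes of boxes -/

lemma vol_coord (A : Set E3) :
    volume A = volume {c : Fin 3 → ℝ | WithLp.toLp 2 c ∈ A} := by
  have h := (PiLp.volume_preserving_toLp (Fin 3))
  have h2 := h.measure_preimage_equiv (f := MeasurableEquiv.toLp 2 (Fin 3 → ℝ)) A
  rw [← h2]
  rfl

lemma vol_upper (A : Set E3) (M : Matrix (Fin 3) (Fin 3) ℝ) (hM : M.det = 1) (l r : Fin 3 → ℝ)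
    (hlr : ∀ i, l i ≤ r i)
    (hA : ∀ y ∈ A, ∀ i, l i ≤ (M.mulVec y.ofLp) i ∧ (M.mulVec y.ofLp) i ≤ r i) :
    (volume A).toReal ≤ (r 0 - l 0) * (r 1 - l 1) * (r 2 - l 2) := by
  rw [vol_coord]
  have hsub : {c : Fin 3 → ℝ | WithLp.toLp 2 c ∈ A} ⊆ (Matrix.toLin' M) ⁻¹' Icc l r := by
    intro c hc
    have := hA _ hc
    exact ⟨fun i => (this i).1, fun i => (this i).2⟩
  have hdet : LinearMap.det (Matrix.toLin' M) ≠ 0 := by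
    rw [LinearMap.det_toLin', hM]; norm_num
  have h1 := measure_mono (μ := volume) hsub
  rw [Measure.addHaar_preimage_linearMap volume hdet, LinearMap.det_toLin', hM,
    Real.volume_Icc_pi, Fin.prod_univ_three] at h1
  simp only [inv_one, abs_one, ENNReal.ofReal_one, one_mul] at h1
  rw [← ENNReal.ofReal_mul (sub_nonneg.2 (hlr 0)), ← ENNReal.ofReal_mul (mul_nonneg (sub_nonneg.2 (hlr 0)) (sub_nonneg.2 (hlr 1)))] at h1
  exact ENNReal.toReal_le_of_le_ofReal (mul_nonneg (mul_nonneg (sub_nonneg.2 (hlr 0)) (sub_nonneg.2 (hlr 1))) (sub_nonneg.2 (hlr 2))) h1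

lemma vol_param (A : Set E3) (W : Matrix (Fin 3) (Fin 3) ℝ) (bb : Fin 3 → ℝ) :
    ENNReal.ofReal |W.det| * volume {c : Fin 3 → ℝ | WithLp.toLp 2 (bb + W.mulVec c) ∈ A}
      ≤ volume A := by
  rw [vol_coord A, ← LinearMap.det_toLin', ← Measure.addHaar_image_linearMap,
    ← measure_preimage_add volume bb {c : Fin 3 → ℝ | WithLp.toLp 2 c ∈ A}]
  apply measure_mono
  rintro _ ⟨c, hc, rfl⟩
  exact hc

lemma vol_lower (A : Set E3) (hfin : volume A ≠ ∞) (W : Matrix (Fin 3) (Fin 3) ℝ)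
    (bb l r : Fin 3 → ℝ) (hlr : ∀ i, l i ≤ r i)
    (hA : ∀ c : Fin 3 → ℝ, (∀ i, l i ≤ c i ∧ c i ≤ r i) → WithLp.toLp 2 (bb + W.mulVec c) ∈ A) :
    |W.det| * ((r 0 - l 0) * (r 1 - l 1) * (r 2 - l 2)) ≤ (volume A).toReal := by
  have h := vol_param A W bb
  have h1 : Icc l r ⊆ {c : Fin 3 → ℝ | WithLp.toLp 2 (bb + W.mulVec c) ∈ A} := by
    intro c hc
    exact hA c (fun i => ⟨hc.1 i, hc.2 i⟩)
  have h2 := (mul_le_mul_right (measure_mono (μ := volume) h1) (ENNReal.ofReal |W.det|)).trans h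
  rw [Real.volume_Icc_pi, Fin.prod_univ_three,
    ← ENNReal.ofReal_mul (sub_nonneg.2 (hlr 0)), ← ENNReal.ofReal_mul (mul_nonneg (sub_nonneg.2 (hlr 0)) (sub_nonneg.2 (hlr 1))),
    ← ENNReal.ofReal_mul (abs_nonneg _)] at h2
  exact (ENNReal.ofReal_le_iff_le_toReal hfin).1 h2

lemma vol_fubini (A : Set E3) (hmeas : MeasurableSet A) (hfin : volume A ≠ ∞)
    (W : Matrix (Fin 3) (Fin 3) ℝ) (l r m : ℝ) (hlr : l ≤ r) (hm : 0 ≤ m)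
    (hA : ∀ α β : ℝ, l ≤ α → α ≤ r → l ≤ β → β ≤ r →
      ENNReal.ofReal m ≤ volume {t : ℝ | WithLp.toLp 2 (W.mulVec ![t, α, β]) ∈ A}) :
    |W.det| * (m * ((r - l) * (r - l))) ≤ (volume A).toReal := by
  have h := vol_param A W 0
  set A' : Set (Fin 3 → ℝ) := {c : Fin 3 → ℝ | WithLp.toLp 2 (0 + W.mulVec c) ∈ A} with hA'
  have hcont : Continuous (fun c : Fin 3 → ℝ => (WithLp.toLp 2 (0 + W.mulVec c) : E3)) := by
    have : Continuous (fun c : Fin 3 → ℝ => W.mulVec c) := by fun_prop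
    fun_prop
  have hmA' : MeasurableSet A' := hcont.measurable hmeas
  have hmp := (volume_preserving_piFinSuccAbove (fun _ : Fin 3 => ℝ) 0).symm
  have h3 := hmp.measure_preimage_equiv A'
  set D : Set (ℝ × (Fin 2 → ℝ)) :=
    (MeasurableEquiv.piFinSuccAbove (fun _ : Fin 3 => ℝ) 0).symm ⁻¹' A' with hD
  have hmD : MeasurableSet D := (MeasurableEquiv.measurable _) hmA'
  have h4 : ENNReal.ofReal (m * ((r - l) * (r - l))) ≤ volume A' := by
    rw [← h3, Measure.volume_eq_prod, Measure.prod_apply_symm hmD]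
    have h5 : ∫⁻ z in (Icc (fun _ => l) (fun _ => r) : Set (Fin 2 → ℝ)), ENNReal.ofReal m
        ≤ ∫⁻ z : Fin 2 → ℝ, volume ((fun x => (x, z)) ⁻¹' D) := by
      refine le_trans ?_ (setLIntegral_le_lintegral (Icc (fun _ => l) (fun _ => r)) _)
      apply setLIntegral_mono' measurableSet_Icc
      intro z hz
      have h6 := hA (z 0) (z 1) (hz.1 0) (hz.2 0) (hz.1 1) (hz.2 1)
      refine h6.trans (measure_mono ?_)
      intro t ht
      change WithLp.toLp 2 (0 + W.mulVec _) ∈ A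
      rw [zero_add]
      have hz : (MeasurableEquiv.piFinSuccAbove (fun _ : Fin 3 => ℝ) 0).symm (t, z)
          = ![t, z 0, z 1] := by
        ext i
        fin_cases i <;> rfl
      change WithLp.toLp 2 (W.mulVec ((MeasurableEquiv.piFinSuccAbove (fun _ : Fin 3 => ℝ) 0).symm (t, z))) ∈ A
      rw [hz]
      exact ht
    refine le_trans ?_ h5
    rw [setLIntegral_const, Real.volume_Icc_pi, Fin.prod_univ_two, ENNReal.ofReal_mul hm,
      ENNReal.ofReal_mul (sub_nonneg.2 hlr)]
  have h7 := (mul_le_mul_right h4 (ENNReal.ofReal |W.det|)).trans h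
  rw [← ENNReal.ofReal_mul (abs_nonneg _)] at h7
  exact (ENNReal.ofReal_le_iff_le_toReal hfin).1 h7
/-! ### Part 3: convex bodies, normals, rotations, axes -/

lemma exists_normal {K : Set E3} (hK : IsConvexBody K) {x : E3} (hx : x ∈ frontier K) :
    ∃ ν, outerNormalAt K x ν := by
  obtain ⟨hc, hk, hi⟩ := hK
  have hxi : x ∉ interior K := hx.2
  obtain ⟨f, hf⟩ := geometric_hahn_banach_open_point hc.interior isOpen_interior hxi
  set w : E3 := (InnerProductSpace.toDual ℝ E3).symm f with hw
  have hwf : ∀ y, ⟪w, y⟫ = f y := fun y => InnerProductSpace.toDual_symm_apply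
  have hle : ∀ z ∈ K, f z ≤ f x := by
    intro z hz
    have hz' : z ∈ closure (interior K) := by
      rw [hc.closure_interior_eq_closure_of_nonempty_interior hi]
      exact subset_closure hz
    have hcl : IsClosed {z | f z ≤ f x} := isClosed_le f.continuous continuous_const
    exact closure_minimal (fun a ha => (hf a ha).le) hcl hz'
  have hw0 : w ≠ 0 := by
    intro h
    obtain ⟨a, ha⟩ := hi
    have h1 := hf a ha
    rw [← hwf, ← hwf, h] at h1
    simp at h1
  have hn : 0 < ‖w‖ := norm_pos_iff.2 hw0
  refine ⟨‖w‖⁻¹ • w, ?_, ?_⟩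
  · rw [norm_smul, norm_inv, norm_norm, inv_mul_cancel₀ hn.ne']
  · intro z hz
    rw [real_inner_smul_left, hwf, map_sub]
    have := hle z hz
    exact mul_nonpos_of_nonneg_of_nonpos (by positivity) (by linarith)

lemma exit_point {K : Set E3} (hK : IsConvexBody K) {y : E3} (hy : y ∈ K) (hy0 : y ≠ 0) :
    ∃ s : ℝ, 1 ≤ s ∧ s • y ∈ frontier K := by
  obtain ⟨hc, hk, hi⟩ := hK
  let S : Set ℝ := {s | s • y ∈ K}
  have hScl : IsClosed S := hk.isClosed.preimage (by fun_prop : Continuous fun s : ℝ => s • y)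
  obtain ⟨B, hB⟩ := hk.isBounded.exists_norm_le
  have hyn : 0 < ‖y‖ := norm_pos_iff.2 hy0
  have hbd : BddAbove S := by
    refine ⟨B / ‖y‖, ?_⟩
    intro s hs
    have h1 := hB _ hs
    rw [norm_smul, Real.norm_eq_abs] at h1
    rw [le_div_iff₀ hyn]
    exact (mul_le_mul_of_nonneg_right (le_abs_self s) hyn.le).trans h1
  have h1S : (1 : ℝ) ∈ S := by simpa [S] using hy
  have hsup : sSup S ∈ S := hScl.csSup_mem ⟨1, h1S⟩ hbd
  refine ⟨sSup S, le_csSup hbd h1S, subset_closure hsup, ?_⟩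
  intro hint
  have ho : IsOpen {s : ℝ | s • y ∈ interior K} :=
    isOpen_interior.preimage (by fun_prop : Continuous fun s : ℝ => s • y)
  obtain ⟨ε, hε, hball⟩ := Metric.isOpen_iff.1 ho (sSup S) hint
  have hmem : sSup S + ε / 2 ∈ ball (sSup S) ε := by
    rw [mem_ball, Real.dist_eq, add_sub_cancel_left, abs_of_pos (by linarith)]; linarith
  have h2 : sSup S + ε / 2 ∈ S := interior_subset (s := K) (hball hmem)
  have := le_csSup hbd h2
  linarith

lemma normal_le {K : Set E3} {x ν z : E3} (h : outerNormalAt K x ν) (hz : z ∈ K) :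
    ν 0 * z 0 + ν 1 * z 1 + ν 2 * z 2 ≤ ν 0 * x 0 + ν 1 * x 1 + ν 2 * x 2 := by
  have := h.2 z hz
  rw [inner_sub_right, e3_inner, e3_inner] at this
  linarith

lemma normal_unit {K : Set E3} {x ν : E3} (h : outerNormalAt K x ν) : ν ∈ unitSphere := by
  rw [unitSphere, mem_sphere_zero_iff_norm]; exact h.1

lemma smul_mem_body {K : Set E3} (hc : Convex ℝ K) (h0 : (0 : E3) ∈ K) {y : E3} (hy : y ∈ K)
    {t : ℝ} (ht0 : 0 ≤ t) (ht1 : t ≤ 1) : t • y ∈ K :=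
  hc.smul_mem_of_zero_mem h0 hy ⟨ht0, ht1⟩

lemma gaussPre_subset {K : Set E3} (hK : IsConvexBody K) (ω : Set E3) : gaussPre K ω ⊆ K :=
  fun _ hx => hK.2.1.isClosed.frontier_subset hx.1

lemma cone_subset {K : Set E3} (hK : IsConvexBody K) (h0 : (0 : E3) ∈ K) (ω : Set E3) :
    coneOver (gaussPre K ω) ⊆ K := by
  rintro y ⟨x, hx, t, ht, rfl⟩
  exact smul_mem_body hK.1 h0 (gaussPre_subset hK ω hx) ht.1 ht.2

lemma mem_cone {K : Set E3} {ω : Set E3} {y ν : E3} {s : ℝ} (hs : 1 ≤ s)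
    (hy : s • y ∈ frontier K) (hν : outerNormalAt K (s • y) ν) (hω : ν ∈ ω) :
    y ∈ coneOver (gaussPre K ω) := by
  refine ⟨s • y, ⟨hy, ν, hω, hν⟩, s⁻¹, ⟨by positivity, inv_le_one_of_one_le₀ hs⟩, ?_⟩
  rw [smul_smul, inv_mul_cancel₀ (by positivity), one_smul]

lemma body_fin {K : Set E3} (hK : IsConvexBody K) {A : Set E3} (hA : A ⊆ K) : volume A ≠ ∞ :=
  ne_top_of_le_ne_top hK.2.1.measure_lt_top.ne (measure_mono hA)

/-- A body whose cone-volume measure is comparable with the surface measure of the sphere. -/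
structure Good (Λ : ℝ) (K : Set E3) : Prop where
  body : IsConvexBody K
  zero : (0 : E3) ∈ K
  fin : μH[2] unitSphere ≠ ∞
  up : ∀ ω : Set E3, ω ⊆ unitSphere → MeasurableSet ω →
    (volume (coneOver (gaussPre K ω))).toReal ≤ Λ * (μH[2] ω).toReal
  low : ∀ ω : Set E3, ω ⊆ unitSphere → MeasurableSet ω →
    (μH[2] ω).toReal ≤ Λ * (volume (coneOver (gaussPre K ω))).toReal

lemma subset_cone_sphere {K : Set E3} (hK : IsConvexBody K) :
    K \ {0} ⊆ coneOver (gaussPre K unitSphere) := by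
  rintro y ⟨hy, hy0⟩
  obtain ⟨s, hs, hf⟩ := exit_point hK hy hy0
  obtain ⟨ν, hν⟩ := exists_normal hK hf
  exact mem_cone hs hf hν (normal_unit hν)

lemma volume_cone_sphere {K : Set E3} (hK : IsConvexBody K) (h0 : (0 : E3) ∈ K) :
    volume (coneOver (gaussPre K unitSphere)) = volume K := by
  apply le_antisymm (measure_mono (cone_subset hK h0 _))
  have : volume (K \ {0}) = volume K := measure_sdiff_null (by simp)
  rw [← this]
  exact measure_mono (subset_cone_sphere hK)

lemma good_of_solves {lam : ℝ} (hlam : 1 < lam) {f : E3 → ℝ} {K : Set E3}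
    (hf : ∀ u ∈ unitSphere, 1 / lam < f u ∧ f u < lam) (hK : IsConvexBody K) (h0 : (0 : E3) ∈ K)
    (hs : SolvesLMP K f) : Good (3 * lam) K := by
  have hlam0 : 0 < lam := by linarith
  have hvpos : 0 < (volume K).toReal := by
    apply ENNReal.toReal_pos _ hK.2.1.measure_lt_top.ne
    exact (Measure.measure_pos_of_nonempty_interior volume hK.2.2).ne'
  have hint : IntegrableOn f unitSphere μH[2] := by
    by_contra hcon
    have h1 := hs unitSphere subset_rfl measurableSet_unitSphere
    rw [integral_undef hcon, volume_cone_sphere hK h0] at h1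
    linarith
  have hfin : μH[2] unitSphere ≠ ∞ := by
    have hc : IntegrableOn (fun _ : E3 => (1 / lam : ℝ)) unitSphere μH[2] := by
      apply Integrable.mono' hint aestronglyMeasurable_const
      rw [ae_restrict_iff' measurableSet_unitSphere]
      refine ae_of_all _ (fun u hu => ?_)
      rw [Real.norm_of_nonneg (by positivity)]
      exact (hf u hu).1.le
    rw [integrableOn_const_iff] at hc
    rcases hc with h | h
    · exfalso
      have : 0 < 1 / lam := by positivity
      simp at h
      linarith
    · exact h.ne
  have hb : ∀ ω : Set E3, ω ⊆ unitSphere → MeasurableSet ω →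
      1 / lam * (μH[2] ω).toReal ≤ ∫ u in ω, f u ∂(μH[2]) ∧
      ∫ u in ω, f u ∂(μH[2]) ≤ lam * (μH[2] ω).toReal := by
    intro ω hω hm
    have hωf : μH[2] ω ≠ ∞ := ne_top_of_le_ne_top hfin (measure_mono hω)
    have hi := hint.mono_set hω
    have e1 : ∀ c : ℝ, ∫ _ in ω, c ∂(μH[2] : Measure E3) = c * (μH[2] ω).toReal := by
      intro c
      rw [setIntegral_const, smul_eq_mul, mul_comm]; rfl
    constructor
    · rw [← e1]
      apply setIntegral_mono_on (integrableOn_const hωf) hi hm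
      intro u hu; exact (hf u (hω hu)).1.le
    · rw [← e1]
      apply setIntegral_mono_on hi (integrableOn_const hωf) hm
      intro u hu; exact (hf u (hω hu)).2.le
  refine ⟨hK, h0, hfin, ?_, ?_⟩
  · intro ω hω hm
    have h1 := hs ω hω hm
    have h2 := (hb ω hω hm).2
    have h3 : 0 ≤ lam * (μH[2] ω).toReal := by positivity
    linarith
  · intro ω hω hm
    have h1 := hs ω hω hm
    have h2 := (hb ω hω hm).1
    rw [← h1, one_div, inv_mul_le_iff₀ hlam0] at h2
    linarith

lemma cone_image (T : E3 ≃ₗᵢ[ℝ] E3) (K ω : Set E3) :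
    coneOver (gaussPre (T '' K) ω) = T '' (coneOver (gaussPre K (T ⁻¹' ω))) := by
  have hfr : frontier (T '' K) = T '' frontier K :=
    (T.toHomeomorph.image_frontier K).symm
  have hn : ∀ x ν : E3, outerNormalAt (T '' K) (T x) (T ν) ↔ outerNormalAt K x ν := by
    intro x ν
    unfold outerNormalAt
    rw [T.norm_map]
    simp only [forall_mem_image, ← map_sub, T.inner_map_map]
  ext y
  constructor
  · rintro ⟨x, ⟨hx, ν, hν, hxν⟩, t, ht, rfl⟩
    rw [hfr] at hx
    obtain ⟨x', hx', rfl⟩ := hx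
    obtain ⟨ν', rfl⟩ := T.surjective ν
    exact ⟨t • x', ⟨x', ⟨hx', ν', hν, (hn _ _).1 hxν⟩, t, ht, rfl⟩, by simp⟩
  · rintro ⟨_, ⟨x, ⟨hx, ν, hν, hxν⟩, t, ht, rfl⟩, rfl⟩
    refine ⟨T x, ⟨?_, T ν, hν, (hn _ _).2 hxν⟩, t, ht, by simp⟩
    rw [hfr]
    exact mem_image_of_mem _ hx

lemma Good.rotate {Λ : ℝ} {K : Set E3} (h : Good Λ K) (T : E3 ≃ₗᵢ[ℝ] E3) : Good Λ (T '' K) := by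
  have hvol : ∀ A : Set E3, volume (T '' A) = volume A := by
    intro A
    have h1 := T.measurePreserving.measure_preimage_equiv (f := T.toMeasurableEquiv) (T '' A)
    rw [← h1]
    congr 1
    exact preimage_image_eq A T.injective
  have hH : ∀ ω : Set E3, μH[2] (T ⁻¹' ω) = μH[2] ω := by
    intro ω
    have := T.toIsometryEquiv.hausdorffMeasure_preimage 2 ω
    exact this
  have hsub : ∀ ω : Set E3, ω ⊆ unitSphere → T ⁻¹' ω ⊆ unitSphere := by
    intro ω hω u hu
    have := hω hu
    rw [unitSphere, mem_sphere_zero_iff_norm] at this ⊢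
    rwa [T.norm_map] at this
  have hmeas : ∀ ω : Set E3, MeasurableSet ω → MeasurableSet (T ⁻¹' ω) :=
    fun ω hω => T.continuous.measurable hω
  refine ⟨⟨?_, ?_, ?_⟩, ⟨0, h.zero, by simp⟩, h.fin, ?_, ?_⟩
  · exact h.body.1.linear_image T.toLinearEquiv.toLinearMap
  · exact h.body.2.1.image T.continuous
  · have : interior (T '' K) = T '' interior K := (T.toHomeomorph.image_interior K).symm
    rw [this]
    exact h.body.2.2.image _
  · intro ω hω hm
    rw [cone_image, hvol, ← hH ω]
    exact h.up _ (hsub ω hω) (hmeas ω hm)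
  · intro ω hω hm
    rw [cone_image, hvol, ← hH ω]
    exact h.low _ (hsub ω hω) (hmeas ω hm)

/-- Adapted coordinates. -/
structure Axes (K : Set E3) (a b R q2 r0 r1 r2 : ℝ) : Prop where
  ha : 0 < a
  hab : a ≤ b
  hbR : b ≤ R
  b0 : ∀ y ∈ K, |y 0| ≤ a
  b1 : ∀ y ∈ K, |y 1| ≤ b
  b2 : ∀ y ∈ K, |y 2| ≤ R
  p : (!₂[0, 0, R] : E3) ∈ K
  q : (!₂[0, b, q2] : E3) ∈ K
  r : (!₂[r0, r1, r2] : E3) ∈ K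
  hr : |r0| = a

lemma exists_axes {Λ : ℝ} {K : Set E3} (h : Good Λ K) :
    ∃ (T : E3 ≃ₗᵢ[ℝ] E3) (a b R q2 r0 r1 r2 : ℝ), Axes (T '' K) a b R q2 r0 r1 r2 ∧
      ∀ y ∈ K, ‖y‖ ≤ R := by
  have hcomp := h.body.2.1
  have hne : K.Nonempty := ⟨0, h.zero⟩
  -- a point of `K` outside of any proper hyperplane
  have hout : ∀ e : E3, e ≠ 0 → ∃ y ∈ K, ⟪e, y⟫ ≠ 0 := by
    intro e he
    by_contra hcon
    push Not at hcon
    obtain ⟨x, hx⟩ := h.body.2.2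
    have hx0 := hcon x (interior_subset hx)
    have hopen : IsOpen {t : ℝ | x + t • e ∈ interior K} :=
      isOpen_interior.preimage (by fun_prop : Continuous fun t : ℝ => x + t • e)
    obtain ⟨ε, hε, hball⟩ := Metric.isOpen_iff.1 hopen 0 (by simpa using hx)
    have hm : ε / 2 ∈ ball (0 : ℝ) ε := by
      rw [mem_ball, Real.dist_eq, sub_zero, abs_of_pos (by linarith)]; linarith
    have h1 := hcon _ (interior_subset (hball hm))
    rw [inner_add_right, hx0, real_inner_smul_right, real_inner_self_eq_norm_sq] at h1
    have : 0 < ‖e‖ := norm_pos_iff.2 he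
    have : 0 < ε / 2 * ‖e‖ ^ 2 := by positivity
    linarith
  obtain ⟨p, hpK, hp⟩ := hcomp.exists_isMaxOn hne (f := fun y => ‖y‖) (by fun_prop)
  have hp' : ∀ y ∈ K, ‖y‖ ≤ ‖p‖ := fun y hy => hp hy
  set R := ‖p‖ with hR
  have hRpos : 0 < R := by
    obtain ⟨y, hy, hy0⟩ := hout (EuclideanSpace.single 0 1) (by simp)
    have hy1 : y ≠ 0 := by rintro rfl; simp at hy0
    exact lt_of_lt_of_le (norm_pos_iff.2 hy1) (hp' y hy)
  set e3 : E3 := R⁻¹ • p with he3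
  have hn3 : ‖e3‖ = 1 := by
    rw [he3, norm_smul, norm_inv, Real.norm_of_nonneg hRpos.le, ← hR, inv_mul_cancel₀ hRpos.ne']
  have hpe : p = R • e3 := by rw [he3, smul_smul, mul_inv_cancel₀ hRpos.ne', one_smul]
  let g : E3 → E3 := fun y => y - ⟪e3, y⟫ • e3
  have hg : Continuous g := by fun_prop
  obtain ⟨q, hqK, hq⟩ := hcomp.exists_isMaxOn hne (f := fun y => ‖g y‖) (by fun_prop)
  have hq' : ∀ y ∈ K, ‖g y‖ ≤ ‖g q‖ := fun y hy => hq hy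
  set b := ‖g q‖ with hb
  have hge : ∀ y, ⟪e3, g y⟫ = 0 := by
    intro y
    simp only [g]
    rw [inner_sub_right, real_inner_smul_right, real_inner_self_eq_norm_sq, hn3]; ring
  have hbpos : 0 < b := by
    rw [hb, norm_pos_iff]
    intro hq0
    -- every vector in K would be a multiple of e3
    have hall : ∀ y ∈ K, g y = 0 := by
      intro y hy
      have := hq' y hy
      rw [hb, hq0, norm_zero] at this
      exact norm_le_zero_iff.1 this
    -- take a vector orthogonal to e3
    have hex : ∃ w : E3, w ≠ 0 ∧ ⟪w, e3⟫ = 0 := by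
      by_cases h0 : e3 0 = 0
      · refine ⟨EuclideanSpace.single 0 1, by simp, ?_⟩
        rw [e3_inner]; simp [h0]
      · refine ⟨!₂[-e3 1, e3 0, 0], ?_, ?_⟩
        · intro hw
          have := congrArg (fun v : E3 => v 1) hw
          simp at this; exact h0 this
        · rw [e3_inner]; simp; ring
    obtain ⟨w, hw, hw3⟩ := hex
    obtain ⟨y, hy, hy0⟩ := hout w hw
    apply hy0
    have : y = ⟪e3, y⟫ • e3 := by
      have := hall y hy
      simp only [g] at this
      exact sub_eq_zero.1 this
    rw [this, real_inner_smul_right, hw3, mul_zero]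
  set e2 : E3 := b⁻¹ • g q with he2
  have hn2 : ‖e2‖ = 1 := by
    rw [he2, norm_smul, norm_inv, Real.norm_of_nonneg hbpos.le, ← hb, inv_mul_cancel₀ hbpos.ne']
  have hqe : g q = b • e2 := by rw [he2, smul_smul, mul_inv_cancel₀ hbpos.ne', one_smul]
  have h32 : ⟪e3, e2⟫ = 0 := by rw [he2, real_inner_smul_right, hge, mul_zero]
  have h23 : ⟪e2, e3⟫ = 0 := by rw [real_inner_comm]; exact h32
  clear_value e2
  let v : Fin 3 → E3 := ![0, e2, e3]
  have hv : Orthonormal ℝ (({1, 2} : Set (Fin 3)).domRestrict v) := by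
    rw [orthonormal_iff_ite]
    rintro ⟨i, hi⟩ ⟨j, hj⟩
    rcases hi with rfl | rfl <;> rcases hj with rfl | rfl
    · rw [if_pos rfl]
      change ⟪e2, e2⟫ = (1 : ℝ)
      rw [real_inner_self_eq_norm_sq, hn2]; norm_num
    · rw [if_neg (fun h => absurd (congrArg Subtype.val h) (by decide))]
      exact h23
    · rw [if_neg (fun h => absurd (congrArg Subtype.val h) (by decide))]
      exact h32
    · rw [if_pos rfl]
      change ⟪e3, e3⟫ = (1 : ℝ)
      rw [real_inner_self_eq_norm_sq, hn3]; norm_num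
  obtain ⟨B, hB⟩ := hv.exists_orthonormalBasis_extension_of_card_eq (by simp)
  have hB1 : B 1 = e2 := by rw [hB 1 (by simp)]; rfl
  have hB2 : B 2 = e3 := by rw [hB 2 (by simp)]; rfl
  let T : E3 ≃ₗᵢ[ℝ] E3 := B.repr
  have hT0 : ∀ y, (T y) 0 = ⟪B 0, y⟫ := fun y => B.repr_apply_apply y 0
  have hT1 : ∀ y, (T y) 1 = ⟪e2, y⟫ := fun y => by rw [← hB1]; exact B.repr_apply_apply y 1
  have hT2 : ∀ y, (T y) 2 = ⟪e3, y⟫ := fun y => by rw [← hB2]; exact B.repr_apply_apply y 2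
  have hB0n : ‖B 0‖ = 1 := B.orthonormal.1 0
  have h02 : ⟪B 0, e3⟫ = 0 := by rw [← hB2]; exact B.orthonormal.2 (by decide)
  have h01 : ⟪B 0, e2⟫ = 0 := by rw [← hB1]; exact B.orthonormal.2 (by decide)
  obtain ⟨r, hrK, hr⟩ := hcomp.exists_isMaxOn hne (f := fun y => |⟪B 0, y⟫|) (by fun_prop)
  have hr' : ∀ y ∈ K, |⟪B 0, y⟫| ≤ |⟪B 0, r⟫| := fun y hy => hr hy
  have hb0 : ∀ y ∈ K, |⟪B 0, y⟫| ≤ b := by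
    intro y hy
    have : ⟪B 0, y⟫ = ⟪B 0, g y⟫ := by
      simp only [g]; rw [inner_sub_right, real_inner_smul_right, h02]; ring
    rw [this]
    have h1 := abs_real_inner_le_norm (B 0) (g y)
    rw [hB0n, one_mul] at h1
    exact h1.trans (hq' y hy)
  have hb1 : ∀ y ∈ K, |⟪e2, y⟫| ≤ b := by
    intro y hy
    have : ⟪e2, y⟫ = ⟪e2, g y⟫ := by
      simp only [g]; rw [inner_sub_right, real_inner_smul_right, h23]; ring
    rw [this]
    have h1 := abs_real_inner_le_norm e2 (g y)
    rw [hn2, one_mul] at h1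
    exact h1.trans (hq' y hy)
  have hqdec : q = b • e2 + ⟪e3, q⟫ • e3 := by rw [← hqe]; simp [g]
  refine ⟨T, |⟪B 0, r⟫|, b, R, (T q) 2, (T r) 0, (T r) 1, (T r) 2, ⟨?_, ?_, ?_, ?_, ?_, ?_, ?_, ?_, ?_, ?_⟩, hp'⟩
  · obtain ⟨y, hy, hy0⟩ := hout (B 0) (by rw [← norm_pos_iff, hB0n]; norm_num)
    exact lt_of_lt_of_le (abs_pos.2 hy0) (hr' y hy)
  · exact hb0 r hrK
  · have h1 : ‖g q‖ ^ 2 ≤ ‖q‖ ^ 2 := by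
      have : ‖g q‖ ^ 2 = ‖q‖ ^ 2 - ⟪e3, q⟫ ^ 2 := by
        simp only [g]
        rw [norm_sub_sq_real, norm_smul, hn3, real_inner_smul_right, real_inner_comm e3 q, mul_one,
          Real.norm_eq_abs, sq_abs]
        ring
      rw [this]; nlinarith [sq_nonneg ⟪e3, q⟫]
    have h2 : ‖g q‖ ≤ ‖q‖ := abs_le_of_sq_le_sq h1 (norm_nonneg _) |> fun h => (le_abs_self _).trans h
    exact h2.trans (hp' q hqK)
  · rintro _ ⟨y, hy, rfl⟩
    rw [hT0]; exact hr' y hy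
  · rintro _ ⟨y, hy, rfl⟩
    rw [hT1]; exact hb1 y hy
  · rintro _ ⟨y, hy, rfl⟩
    rw [hT2]
    have h1 := abs_real_inner_le_norm e3 y
    rw [hn3, one_mul] at h1
    exact h1.trans (hp' y hy)
  · refine ⟨p, hpK, ?_⟩
    ext i
    fin_cases i
    · change (T p) 0 = 0
      rw [hT0, hpe, real_inner_smul_right, h02, mul_zero]
    · change (T p) 1 = 0
      rw [hT1, hpe, real_inner_smul_right, h23, mul_zero]
    · change (T p) 2 = R
      rw [hT2, hpe, real_inner_smul_right, real_inner_self_eq_norm_sq, hn3]; ring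
  · refine ⟨q, hqK, ?_⟩
    ext i
    fin_cases i
    · change (T q) 0 = 0
      rw [hT0, hqdec, inner_add_right, real_inner_smul_right, real_inner_smul_right, h02, h01]; ring
    · change (T q) 1 = b
      rw [hT1, hqdec, inner_add_right, real_inner_smul_right, real_inner_smul_right, h23,
        real_inner_self_eq_norm_sq, hn2]; ring
    · rfl
  · refine ⟨r, hrK, ?_⟩
    ext i
    fin_cases i <;> rfl
  · rw [hT0]
/-! ### Part 4: the elongated case -/

lemma comb3 {K : Set E3} (hc : Convex ℝ K) (h0 : (0 : E3) ∈ K) {p q r : E3} (hp : p ∈ K)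
    (hq : q ∈ K) (hr : r ∈ K) {α β γ : ℝ} (hα : 0 ≤ α) (hβ : 0 ≤ β) (hγ : 0 ≤ γ)
    (hs : α + β + γ ≤ 1) : α • p + β • q + γ • r ∈ K := by
  have h := hc.sum_mem (t := Finset.univ) (w := ![α, β, γ, 1 - α - β - γ]) (z := ![p, q, r, 0])
    (by intro i _; fin_cases i <;> simp <;> linarith) (by simp [Fin.sum_univ_four])
    (by intro i _; fin_cases i <;> simp <;> assumption)
  simpa [Fin.sum_univ_four] using h

lemma Axes.b_pos {K : Set E3} {a b R q2 r0 r1 r2 : ℝ} (A : Axes K a b R q2 r0 r1 r2) : 0 < b :=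
  lt_of_lt_of_le A.ha A.hab

lemma Axes.R_pos {K : Set E3} {a b R q2 r0 r1 r2 : ℝ} (A : Axes K a b R q2 r0 r1 r2) : 0 < R :=
  lt_of_lt_of_le A.b_pos A.hbR

lemma Axes.hq2 {K : Set E3} {a b R q2 r0 r1 r2 : ℝ} (A : Axes K a b R q2 r0 r1 r2) : |q2| ≤ R := by
  simpa using A.b2 _ A.q

lemma Axes.hr2 {K : Set E3} {a b R q2 r0 r1 r2 : ℝ} (A : Axes K a b R q2 r0 r1 r2) : |r2| ≤ R := by
  simpa using A.b2 _ A.r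

lemma vol_slab {K : Set E3} {a b R q2 r0 r1 r2 : ℝ} (A : Axes K a b R q2 r0 r1 r2) {S : Set E3}
    (hS : S ⊆ K) {z1 z2 : ℝ} (hz : z1 ≤ z2) (h : ∀ y ∈ S, z1 ≤ y 2 ∧ y 2 ≤ z2) :
    (volume S).toReal ≤ 4 * (a * b) * (z2 - z1) := by
  have hb := A.b_pos
  have ha := A.ha
  have h1 := vol_upper S 1 (by simp) ![-a, -b, z1] ![a, b, z2]
    (by intro i; fin_cases i <;> simp <;> linarith) (by
      intro y hy i
      have h0 := abs_le.1 (A.b0 y (hS hy))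
      have h1 := abs_le.1 (A.b1 y (hS hy))
      have h2 := h y hy
      fin_cases i
      · simpa using h0
      · simpa using h1
      · simpa using h2)
  simp at h1
  linarith

lemma vol_le_axes {K : Set E3} {a b R q2 r0 r1 r2 : ℝ} (A : Axes K a b R q2 r0 r1 r2) :
    (volume K).toReal ≤ 8 * (a * b * R) := by
  have := vol_slab A (S := K) subset_rfl (z1 := -R) (z2 := R) (by linarith [A.R_pos])
    (fun y hy => abs_le.1 (A.b2 y hy))
  linarith

lemma axes_le_vol {K : Set E3} (hK : IsConvexBody K) (h0 : (0 : E3) ∈ K)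
    {a b R q2 r0 r1 r2 : ℝ} (A : Axes K a b R q2 r0 r1 r2) :
    a * b * R ≤ 27 * (volume K).toReal := by
  have h := vol_lower K (body_fin hK subset_rfl) !![r0, 0, 0; r1, b, 0; r2, q2, R] 0
    ![0, 0, 0] ![1 / 3, 1 / 3, 1 / 3] (by intro i; fin_cases i <;> simp) (by
      intro c hc
      have c0 := hc 0
      have c1 := hc 1
      have c2 := hc 2
      simp at c0 c1 c2
      have := comb3 hK.1 h0 A.p A.q A.r c2.1 c1.1 c0.1 (by linarith)
      convert this using 1
      ext i
      fin_cases i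
      · simp [dotProduct, Fin.sum_univ_three]; ring
      · simp [dotProduct, Fin.sum_univ_three]; ring
      · simp [dotProduct, Fin.sum_univ_three]; ring)
  rw [Matrix.det_fin_three] at h
  simp [abs_mul, A.hr, abs_of_pos A.b_pos, abs_of_pos A.R_pos] at h
  linarith

lemma sphere_ge_one (hfin : μH[2] unitSphere ≠ ∞) : 1 ≤ (μH[2] unitSphere).toReal := by
  have h := strip_lower hfin (c := 0) (s := 1) (σ := 1 / 2) (by norm_num) (by norm_num) le_rfl
  have h2 : (μH[2] (strip 0 1 (1 / 2))).toReal ≤ (μH[2] unitSphere).toReal :=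
    ENNReal.toReal_mono hfin (measure_mono (fun u hu => hu.1))
  linarith

lemma Good.abR_le {Λ : ℝ} {K : Set E3} (G : Good Λ K)
    {a b R q2 r0 r1 r2 : ℝ} (A : Axes K a b R q2 r0 r1 r2) :
    a * b * R ≤ 27 * Λ * (μH[2] unitSphere).toReal := by
  have h1 := axes_le_vol G.body G.zero A
  have h2 := G.up unitSphere subset_rfl measurableSet_unitSphere
  rw [volume_cone_sphere G.body G.zero] at h2
  linarith

lemma Good.le_abR {Λ : ℝ} (hΛ : 0 < Λ) {K : Set E3} (G : Good Λ K)
    {a b R q2 r0 r1 r2 : ℝ} (A : Axes K a b R q2 r0 r1 r2) :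
    1 / (8 * Λ) ≤ a * b * R := by
  have h1 := vol_le_axes A
  have h2 := G.low unitSphere subset_rfl measurableSet_unitSphere
  rw [volume_cone_sphere G.body G.zero] at h2
  have h3 := sphere_ge_one G.fin
  rw [div_le_iff₀ (by positivity)]
  nlinarith

/-- lower end of `K` lies deep below the origin -/
lemma long_depth {Λ B η : ℝ} (hΛ : 0 < Λ) (hB : 0 < B) (hη : 32 * Λ * B * η ≤ 1)
    {K : Set E3} (G : Good Λ K) {a b R q2 r0 r1 r2 : ℝ} (A : Axes K a b R q2 r0 r1 r2)
    (hAB : a * b * R ≤ B) (hb : b ≤ η * R) :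
    ∃ q' ∈ K, q' 2 < -(1 / (8 * Λ * B) * R) := by
  by_contra hcon
  push Not at hcon
  have ha0 := A.ha
  have hb0 := A.b_pos
  have hR0 := A.R_pos
  set κ := 1 / (8 * Λ * B) with hκ
  have hκ0 : 0 < κ := by positivity
  have hκB : κ * B * Λ = 1 / 8 := by rw [hκ]; field_simp
  have h1 := strip_lower G.fin (c := 0) (s := 1) (σ := 1 / 2) (by norm_num) (by norm_num) le_rfl
  have h2 := G.low (strip 0 1 (1 / 2)) (fun u hu => hu.1) (measurableSet_strip _ _ _)
  have h3 := vol_slab A (cone_subset G.body G.zero (strip 0 1 (1 / 2))) (z1 := -(κ * R)) (z2 := 2 * b)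
    (by nlinarith [mul_pos hκ0 hR0]) (by
      intro y hy
      refine ⟨hcon y (cone_subset G.body G.zero _ hy), ?_⟩
      obtain ⟨Y, hY, t, ht, rfl⟩ := hy
      have hYK := gaussPre_subset G.body _ hY
      obtain ⟨hYf, u, hu, hn⟩ := hY
      have hz := normal_le hn G.zero
      obtain ⟨hus, hu0, hu1, hu2⟩ := hu
      rw [mem_unitSphere] at hus
      simp at hz hu1 hu2 hu0
      have y0 := abs_le.1 (A.b0 Y hYK)
      have y1 := abs_le.1 (A.b1 Y hYK)
      have hab := A.hab
      have t1 : u 0 * Y 0 ≤ b / 2 := by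
        have : |u 0 * Y 0| ≤ 1 / 2 * b := by
          rw [abs_mul]
          exact mul_le_mul (by linarith) ((abs_le.2 y0).trans hab) (abs_nonneg _) (by norm_num)
        linarith [le_abs_self (u 0 * Y 0)]
      have t2 : u 1 * Y 1 ≤ b / 2 := by
        have : |u 1 * Y 1| ≤ 1 / 2 * b := by
          rw [abs_mul]
          exact mul_le_mul (by linarith) (abs_le.2 y1) (abs_nonneg _) (by norm_num)
        linarith [le_abs_self (u 1 * Y 1)]
      have hu0' := sq_le_sq' (abs_le.1 hu0).1 (abs_le.1 hu0).2
      have hu1' := sq_le_sq' (abs_le.1 hu1).1 (abs_le.1 hu1).2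
      have hu2' : u 2 ≤ -(1 / 2) := by nlinarith
      have hY2 : Y 2 ≤ 2 * b := by
        by_contra hc
        push Not at hc
        nlinarith
      simp
      nlinarith [ht.1, ht.2])
  have h4 : 4 * (a * b) * (2 * b - -(κ * R)) ≤ 4 * (κ * B) + 8 * (η * B) := by
    have e1 : 4 * (a * b) * (2 * b - -(κ * R)) = 8 * (a * b) * b + 4 * κ * (a * b * R) := by ring
    have e2 : 8 * (a * b) * b ≤ 8 * (a * b) * (η * R) := by gcongr
    have e3 : 4 * κ * (a * b * R) ≤ 4 * κ * B := by gcongr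
    have hη0 : 0 < η := by
      by_contra hc
      push Not at hc
      nlinarith
    have e4 : 8 * η * (a * b * R) ≤ 8 * η * B := by gcongr
    linarith
  have h5 : 1 ≤ Λ * (4 * (κ * B) + 8 * (η * B)) := by
    refine le_trans (by linarith) (h2.trans ?_)
    exact mul_le_mul_of_nonneg_left (h3.trans h4) hΛ.le
  nlinarith

lemma long_lower {s : ℝ} (hs0 : 0 < s) (hs : s ≤ 1 / 8) {K : Set E3} (hK : IsConvexBody K)
    (h0 : (0 : E3) ∈ K) {a b R q2 r0 r1 r2 : ℝ} (A : Axes K a b R q2 r0 r1 r2) {κ : ℝ} (hκ : 0 < κ)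
    {q' : E3} (hq' : q' ∈ K) (hq'2 : q' 2 < -(κ * R)) :
    (κ / 2) ^ 3 * (a * b * R) * s / 256 ≤
      (volume {y : E3 | y ∈ K ∧ 0 ≤ y 2 ∧ y 2 ≤ s * R}).toReal := by
  have ha0 := A.ha
  have hb0 := A.b_pos
  have hR0 := A.R_pos
  set d : ℝ := -q' 2 with hd
  have hdκ : κ * R ≤ d := by linarith
  have hd0 : 0 < d := lt_of_lt_of_le (by positivity) hdκ
  have hdR : d ≤ R := by
    have := (abs_le.1 (A.b2 q' hq')).1
    linarith
  set ρ : ℝ := d / (d + R / 2) with hρ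
  have hρ0 : 0 < ρ := by positivity
  have hρ1 : ρ ≤ 1 := by rw [hρ, div_le_one (by positivity)]; linarith
  have hρd : ρ * (d + R / 2) = d := by rw [hρ]; field_simp
  have hρκ : κ / 2 ≤ ρ := by
    rw [hρ, le_div_iff₀ (by positivity)]
    nlinarith
  have hq2 := abs_le.1 A.hq2
  have hr2 := abs_le.1 A.hr2
  have h := vol_lower {y : E3 | y ∈ K ∧ 0 ≤ y 2 ∧ y 2 ≤ s * R} (body_fin hK (fun y hy => hy.1))
    !![ρ * r0, 0, 0; ρ * r1, ρ * b, 0; 0, 0, ρ]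
    ![(1 - ρ) * q' 0, (1 - ρ) * q' 1, (1 - ρ) * q' 2 + ρ * (R / 2)]
    ![0, 0, 0] ![1 / 16, 1 / 16, s * R] (by intro i; fin_cases i <;> simp; positivity) (by
      intro c hc
      have c0 := hc 0
      have c1 := hc 1
      have c2 := hc 2
      simp at c0 c1 c2
      set α : ℝ := (R / 2 + c 2 - c 1 * q2 - c 0 * r2) / R with hα
      have hαR : α * R = R / 2 + c 2 - c 1 * q2 - c 0 * r2 := by rw [hα]; field_simp
      have k1 : c 1 * q2 ≤ R / 16 := by nlinarith
      have k2 : c 0 * r2 ≤ R / 16 := by nlinarith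
      have k3 : -(R / 16) ≤ c 1 * q2 := by nlinarith
      have k4 : -(R / 16) ≤ c 0 * r2 := by nlinarith
      have k5 : s * R ≤ R / 8 := by nlinarith
      have hα0 : 0 ≤ α := by
        rw [hα]; apply div_nonneg _ hR0.le; linarith
      have hα1 : α ≤ 3 / 4 := by
        rw [hα, div_le_iff₀ hR0]; linarith
      have hm := comb3 hK.1 h0 A.p A.q A.r hα0 c1.1 c0.1 (by linarith)
      have hcv := convex_iff_forall_pos.1 hK.1
      have hρ1' : ρ < 1 := by rw [hρ, div_lt_one (by positivity)]; linarith
      have hm2 := hcv hq' hm (by linarith : 0 < 1 - ρ) hρ0 (by ring)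
      refine ⟨?_, ?_, ?_⟩
      · convert hm2 using 1
        ext i
        fin_cases i
        · simp [dotProduct, Fin.sum_univ_three]; ring
        · simp [dotProduct, Fin.sum_univ_three]; ring
        · simp [dotProduct, Fin.sum_univ_three, hαR]; ring
      · simp [dotProduct, Fin.sum_univ_three]
        nlinarith
      · simp [dotProduct, Fin.sum_univ_three]
        nlinarith)
  generalize (volume {y : E3 | y ∈ K ∧ 0 ≤ y 2 ∧ y 2 ≤ s * R}).toReal = X at h ⊢
  rw [Matrix.det_fin_three] at h
  simp [abs_mul, A.hr, abs_of_pos A.b_pos, abs_of_pos hρ0] at h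
  refine le_trans ?_ h
  have e : ρ * a * (ρ * b) * ρ * (16⁻¹ * 16⁻¹ * (s * R)) = ρ ^ 3 * (a * b * R) * s / 256 := by ring
  rw [e]
  gcongr

set_option maxHeartbeats 2000000 in
open scoped Pointwise in
lemma long_upper {s κ' δ ε Λ η B : ℝ} (hs0 : 0 < s) (hκ' : 0 < κ') (hκs : κ' ≤ s) (hs : s ≤ 1 / 8) (hΛ : 0 < Λ)
    (hδ : 0 < δ) (hη8 : 8 * η ≤ δ) (hη2 : 2 * η ≤ κ' * δ)
    {K : Set E3} (G : Good Λ K) (hε : (μH[2] (band δ)).toReal ≤ ε)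
    {a b R q2 r0 r1 r2 : ℝ} (A : Axes K a b R q2 r0 r1 r2)
    (hAB : a * b * R ≤ B) (hb : b ≤ η * R) :
    (volume {y : E3 | y ∈ K ∧ 0 ≤ y 2 ∧ y 2 ≤ s * R}).toReal ≤
      4 * B * κ' + Λ * ε + 19 * B * s ^ 3 := by
  have ha0 := A.ha
  have hb0 := A.b_pos
  have hR0 := A.R_pos
  have hK := G.body
  have h0 := G.zero
  set A1 : Set E3 := {y : E3 | y ∈ K ∧ 0 ≤ y 2 ∧ y 2 ≤ κ' * R} with hA1
  set A2 : Set E3 := coneOver (gaussPre K (band δ)) with hA2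
  set A3 : Set E3 := (4 * s / 3) • K with hA3
  have hsub : {y : E3 | y ∈ K ∧ 0 ≤ y 2 ∧ y 2 ≤ s * R} ⊆ A1 ∪ A2 ∪ A3 := by
    rintro y ⟨hy, hy0, hys⟩
    by_cases hyk : y 2 ≤ κ' * R
    · exact Or.inl (Or.inl ⟨hy, hy0, hyk⟩)
    push Not at hyk
    have hkR : 0 < κ' * R := by positivity
    have hyne : y ≠ 0 := by
      rintro rfl
      simp at hyk
      linarith
    obtain ⟨t, ht, hf⟩ := exit_point hK hy hyne
    have hYK : t • y ∈ K := hK.2.1.isClosed.frontier_subset hf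
    set Y := t • y with hY
    have hY2 : Y 2 = t * y 2 := by simp [hY]
    by_cases hYR : Y 2 ≤ 3 * R / 4
    · left; right
      obtain ⟨u, hu⟩ := exists_normal hK hf
      refine mem_cone ht hf hu ⟨normal_unit hu, ?_⟩
      have hus := normal_unit hu
      rw [mem_unitSphere] at hus
      have n0 := normal_le hu h0
      have n1 := normal_le hu A.p
      simp at n0 n1
      have y0 := A.b0 Y hYK
      have y1 := A.b1 Y hYK
      have u0 : |u 0| ≤ 1 := abs_le_of_sq_le_sq (by nlinarith [sq_nonneg (u 1), sq_nonneg (u 2)]) (by norm_num)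
      have u1 : |u 1| ≤ 1 := abs_le_of_sq_le_sq (by nlinarith [sq_nonneg (u 0), sq_nonneg (u 2)]) (by norm_num)
      have t1 : u 0 * Y 0 ≤ b := by
        refine (le_abs_self _).trans ?_
        rw [abs_mul]
        have := mul_le_mul u0 (y0.trans A.hab) (abs_nonneg _) (by norm_num)
        linarith
      have t2 : u 1 * Y 1 ≤ b := by
        refine (le_abs_self _).trans ?_
        rw [abs_mul]
        have := mul_le_mul u1 y1 (abs_nonneg _) (by norm_num)
        linarith
      have hYk : κ' * R ≤ Y 2 := by rw [hY2]; nlinarith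
      rw [abs_le]
      constructor
      · by_contra hc
        push Not at hc
        have : δ * (κ' * R) < -(u 2) * Y 2 := by
          have : δ * (κ' * R) < -(u 2) * (κ' * R) := by
            apply mul_lt_mul_of_pos_right _ hkR; linarith
          have h2 : -(u 2) * (κ' * R) ≤ -(u 2) * Y 2 := by
            apply mul_le_mul_of_nonneg_left hYk; linarith
          linarith
        have h3 : 2 * η * R ≤ κ' * δ * R := by gcongr
        nlinarith
      · by_contra hc
        push Not at hc
        have h1 : u 2 * (R / 4) ≤ u 2 * (R - Y 2) := by
          apply mul_le_mul_of_nonneg_left _ (by linarith); linarith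
        have h2 : δ * (R / 4) < u 2 * (R / 4) := by
          apply mul_lt_mul_of_pos_right hc; positivity
        have h3 : 8 * η * (R / 4) ≤ δ * (R / 4) := by gcongr
        nlinarith
    · right
      push Not at hYR
      have ht0 : 0 < t := by linarith
      refine ⟨(3 / (4 * s * t)) • Y, smul_mem_body hK.1 h0 hYK (by positivity) ?_, ?_⟩
      · rw [div_le_one (by positivity)]
        have : 3 * R / 4 < t * (s * R) := by
          refine lt_of_lt_of_le hYR ?_
          rw [hY2]; gcongr
        nlinarith
      · simp only [hY]
        rw [smul_smul, smul_smul]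
        have : 4 * s / 3 * (3 / (4 * s * t)) * t = 1 := by field_simp
        rw [this, one_smul]
  have hKf : volume K ≠ ∞ := body_fin hK subset_rfl
  have hA3v : volume A3 = ENNReal.ofReal ((4 * s / 3) ^ 3) * volume K := by
    rw [hA3, Measure.addHaar_smul]
    simp only [finrank_euclideanSpace, Fintype.card_fin]
    rw [abs_of_pos (by positivity)]
  have f1 : volume A1 ≠ ∞ := body_fin hK (fun y hy => hy.1)
  have f2 : volume A2 ≠ ∞ := body_fin hK (cone_subset hK h0 _)
  have f3 : volume A3 ≠ ∞ := by rw [hA3v]; exact ENNReal.mul_ne_top ENNReal.ofReal_ne_top hKf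
  have hle : (volume {y : E3 | y ∈ K ∧ 0 ≤ y 2 ∧ y 2 ≤ s * R}).toReal ≤
      (volume A1).toReal + (volume A2).toReal + (volume A3).toReal := by
    rw [← ENNReal.toReal_add f1 f2, ← ENNReal.toReal_add (ENNReal.add_ne_top.2 ⟨f1, f2⟩) f3]
    apply ENNReal.toReal_mono (ENNReal.add_ne_top.2 ⟨ENNReal.add_ne_top.2 ⟨f1, f2⟩, f3⟩)
    exact (measure_mono hsub).trans ((measure_union_le _ _).trans (add_le_add_left (measure_union_le _ _) _))
  have v1 : (volume A1).toReal ≤ 4 * B * κ' := by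
    have := vol_slab A (S := A1) (fun y hy => hy.1) (z1 := 0) (z2 := κ' * R) (by positivity) (fun y hy => hy.2)
    have h2 : 4 * κ' * (a * b * R) ≤ 4 * κ' * B := by gcongr
    linarith
  have v2 : (volume A2).toReal ≤ Λ * ε := by
    refine (G.up (band δ) (fun u hu => hu.1) (measurableSet_band δ)).trans ?_
    gcongr
  have v3 : (volume A3).toReal ≤ 19 * B * s ^ 3 := by
    rw [hA3v, ENNReal.toReal_mul, ENNReal.toReal_ofReal (by positivity)]
    have h1 := vol_le_axes A
    have hB : 0 < B := lt_of_lt_of_le (by positivity) hAB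
    calc (4 * s / 3) ^ 3 * (volume K).toReal ≤ (4 * s / 3) ^ 3 * (8 * B) := by
          gcongr; linarith
      _ = (512 / 27) * (B * s ^ 3) := by ring
      _ ≤ 19 * B * s ^ 3 := by
          have : 0 < B * s ^ 3 := by positivity
          nlinarith
  linarith

lemma long_case {Λ : ℝ} (hΛ : 0 < Λ) (hfin : μH[2] unitSphere ≠ ∞) :
    ∃ η > 0, ∀ (K : Set E3) (a b R q2 r0 r1 r2 : ℝ), Good Λ K → Axes K a b R q2 r0 r1 r2 →
      η * R ≤ b := by
  set M := (μH[2] unitSphere).toReal with hM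
  have hM1 : 1 ≤ M := sphere_ge_one hfin
  set B : ℝ := 27 * Λ * M with hB
  have hB0 : 0 < B := by positivity
  set κ : ℝ := 1 / (8 * Λ * B) with hκ
  have hκ0 : 0 < κ := by positivity
  set c0 : ℝ := (κ / 2) ^ 3 * (1 / (8 * Λ)) / 256 with hc0
  have hc0p : 0 < c0 := by positivity
  obtain ⟨s, hs0, hs1, hs2⟩ : ∃ s : ℝ, 0 < s ∧ s ≤ 1 / 8 ∧ 76 * B * s ≤ c0 := by
    refine ⟨min (1 / 8) (c0 / (76 * B)), by positivity, min_le_left _ _, ?_⟩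
    have := min_le_right (1 / 8) (c0 / (76 * B))
    rw [le_div_iff₀ (by positivity)] at this
    linarith
  obtain ⟨κ', hκ'0, hκ's, hκ'2⟩ : ∃ κ' : ℝ, 0 < κ' ∧ κ' ≤ s ∧ 16 * B * κ' ≤ c0 * s := by
    refine ⟨min s (c0 * s / (16 * B)), by positivity, min_le_left _ _, ?_⟩
    have := min_le_right s (c0 * s / (16 * B))
    rw [le_div_iff₀ (by positivity)] at this
    linarith
  set ε : ℝ := c0 * s / (4 * Λ) with hε
  have hε0 : 0 < ε := by positivity
  obtain ⟨δ, hδ, hδε⟩ := exists_band hfin hε0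
  obtain ⟨η, hη0, hη1, hη2, hη3⟩ : ∃ η : ℝ, 0 < η ∧ 32 * Λ * B * η ≤ 1 ∧ 8 * η ≤ δ ∧ 2 * η ≤ κ' * δ := by
    refine ⟨min (1 / (32 * Λ * B)) (min (δ / 8) (κ' * δ / 2)), by positivity, ?_, ?_, ?_⟩
    · have := min_le_left (1 / (32 * Λ * B)) (min (δ / 8) (κ' * δ / 2))
      rw [le_div_iff₀ (by positivity)] at this
      linarith
    · have := (min_le_right (1 / (32 * Λ * B)) (min (δ / 8) (κ' * δ / 2))).trans (min_le_left _ _)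
      linarith
    · have := (min_le_right (1 / (32 * Λ * B)) (min (δ / 8) (κ' * δ / 2))).trans (min_le_right _ _)
      linarith
  refine ⟨η, hη0, ?_⟩
  intro K a b R q2 r0 r1 r2 G A
  by_contra hcon
  push Not at hcon
  have hAB : a * b * R ≤ B := G.abR_le A
  obtain ⟨q', hq', hq'2⟩ := long_depth hΛ hB0 hη1 G A hAB hcon.le
  have hlow := long_lower hs0 hs1 G.body G.zero A hκ0 hq' hq'2
  have hup := long_upper hs0 hκ'0 hκ's hs1 hΛ hδ hη2 hη3 G hδε A hAB hcon.le
  have h1 : c0 * s ≤ (κ / 2) ^ 3 * (a * b * R) * s / 256 := by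
    have h2 := G.le_abR hΛ A
    have : c0 * s = (κ / 2) ^ 3 * (1 / (8 * Λ)) * s / 256 := by rw [hc0]; ring
    rw [this]
    gcongr
  have h3 : Λ * ε = c0 * s / 4 := by rw [hε]; field_simp
  have h4 : 19 * B * s ^ 3 ≤ c0 * s / 4 := by
    have h5 : s ^ 2 ≤ s := by nlinarith
    have h6 : 76 * B * s ^ 2 ≤ c0 := le_trans (by gcongr) hs2
    nlinarith
  have h7 : 0 < c0 * s := by positivity
  linarith
/-! ### Part 5: the flat case -/

lemma flat_arith {a h x P Q α β : ℝ} (hx : |x| ≤ a) (hα : 1 / 4 ≤ α) (hβ : 1 / 4 ≤ β)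
    (hαβ : α + β ≤ 6 / 7) (h0 : 0 ≤ h) (hP : P ≤ h) (hQ : Q ≤ h) (he : h = x + α * P + β * Q) :
    |P| ≤ 7 * a ∧ |Q| ≤ 7 * a := by
  have hx' := abs_le.1 hx
  have ha : 0 ≤ a := (abs_nonneg _).trans hx
  have p1 : α * P ≤ α * h := mul_le_mul_of_nonneg_left hP (by linarith)
  have q1 : β * Q ≤ β * h := mul_le_mul_of_nonneg_left hQ (by linarith)
  have s1 : (α + β) * h ≤ 6 / 7 * h := mul_le_mul_of_nonneg_right hαβ h0
  have hh : h ≤ 7 * a := by nlinarith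
  have a1 : β * h ≤ h := by nlinarith
  have a2 : α * h ≤ h := by nlinarith
  constructor
  · rw [abs_le]
    refine ⟨?_, by linarith⟩
    by_contra hc
    push Not at hc
    have : -a ≤ α * P := by linarith
    nlinarith
  · rw [abs_le]
    refine ⟨?_, by linarith⟩
    by_contra hc
    push Not at hc
    have : -a ≤ β * Q := by linarith
    nlinarith

lemma flat_band {Λ δ : ℝ} {K : Set E3} (G : Good Λ K) {a b R q2 r0 r1 r2 : ℝ}
    (A : Axes K a b R q2 r0 r1 r2) (hδ : 7 * a ≤ δ * R) {y : E3} (hy : y ∈ K)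
    (hy8 : (8 / 7 : ℝ) • y ∉ K) {α β : ℝ} (hα : 1 / 4 ≤ α) (hα' : α ≤ 3 / 8) (hβ : 1 / 4 ≤ β)
    (hβ' : β ≤ 3 / 8) (hy1 : y 1 = β * b) (hy2 : y 2 = α * R + β * q2) :
    y ∈ coneOver (gaussPre K (band δ)) := by
  have hb0 := A.b_pos
  have hR0 := A.R_pos
  have hK := G.body
  have hyne : y ≠ 0 := by
    rintro rfl
    simp at hy1
    rcases hy1 with h | h <;> linarith
  obtain ⟨s, hs, hf⟩ := exit_point hK hy hyne
  have hYK : s • y ∈ K := hK.2.1.isClosed.frontier_subset hf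
  have hs8 : s < 8 / 7 := by
    by_contra hc
    push Not at hc
    apply hy8
    have h1 := smul_mem_body hK.1 G.zero hYK (t := 8 / 7 / s) (by positivity)
      (by rw [div_le_one (by positivity)]; exact hc)
    rwa [smul_smul, div_mul_cancel₀ _ (by positivity)] at h1
  obtain ⟨u, hu⟩ := exists_normal hK hf
  refine mem_cone hs hf hu ⟨normal_unit hu, ?_⟩
  have hus := normal_unit hu
  rw [mem_unitSphere] at hus
  have n0 := normal_le hu G.zero
  have n1 := normal_le hu A.p
  have n2 := normal_le hu A.q
  have y0 := A.b0 _ hYK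
  simp [hy1, hy2] at n0 n1 n2 y0
  have u0 : |u 0| ≤ 1 :=
    abs_le_of_sq_le_sq (by nlinarith [sq_nonneg (u 1), sq_nonneg (u 2)]) (by norm_num)
  have hx : |u 0 * (s * y 0)| ≤ a := by
    rw [abs_mul, abs_mul]
    calc |u 0| * (|s| * |y 0|) ≤ 1 * a := by
          rw [← abs_mul]
          refine mul_le_mul u0 ?_ (abs_nonneg _) (by norm_num)
          rwa [abs_mul]
      _ = a := one_mul a
  have key := flat_arith (h := u 0 * (s * y 0) + u 1 * (s * (β * b)) + u 2 * (s * (α * R + β * q2)))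
    (P := u 2 * R) (Q := u 1 * b + u 2 * q2) (α := s * α) (β := s * β) hx
    (by nlinarith) (by nlinarith) (by nlinarith) n0 n1 n2 (by ring)
  have h1 := key.1
  rw [abs_mul, abs_of_pos hR0] at h1
  exact le_of_mul_le_mul_right (h1.trans hδ) hR0

lemma flat_support {K : Set E3} (hK : IsConvexBody K) (h0 : (0 : E3) ∈ K) {a b R q2 r0 r1 r2 : ℝ}
    (A : Axes K a b R q2 r0 r1 r2) {α β ε τ : ℝ} (hα : 1 / 4 ≤ α) (hα' : α ≤ 3 / 8)
    (hβ : 1 / 4 ≤ β) (hβ' : β ≤ 3 / 8) (hε : 0 < ε) (hεa : ε ≤ a) (hτ : τ * τ = 1) :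
    ∃ g c v1 v2 : ℝ, (!₂[g, β * b, α * R + β * q2] : E3) ∈ K ∧
      (∀ y ∈ K, τ * y 0 ≤ c + v1 * y 1 + v2 * y 2) ∧
      c + v1 * (β * b) + v2 * (α * R + β * q2) = τ * g + ε ∧ 0 ≤ c ∧ c / 4 ≤ τ * g + ε ∧
      0 ≤ τ * g ∧
      |v1| * b ≤ 28 * a ∧ |v2| * R ≤ 14 * a := by
  have ha0 := A.ha
  have hb0 := A.b_pos
  have hR0 := A.R_pos
  let X : ℝ → E3 := fun t => !₂[t, β * b, α * R + β * q2]
  have hXc : Continuous X := by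
    apply (PiLp.continuous_toLp 2 _).comp
    refine continuous_pi fun i => ?_
    fin_cases i
    · exact continuous_id
    · exact continuous_const
    · exact continuous_const
  have hFcl : IsClosed (X ⁻¹' K) := hK.2.1.isClosed.preimage hXc
  have hFc : IsCompact (X ⁻¹' K) := by
    refine IsCompact.of_isClosed_subset (isCompact_Icc (a := -a) (b := a)) hFcl ?_
    intro t ht
    have := A.b0 _ ht
    simp [X] at this
    exact abs_le.1 this
  have hF0 : (0 : ℝ) ∈ X ⁻¹' K := by
    have := comb3 hK.1 h0 A.p A.q h0 (α := α) (β := β) (γ := 0) (by linarith) (by linarith) le_rfl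
      (by linarith)
    show X 0 ∈ K
    convert this using 1
    ext i
    fin_cases i <;> simp [X]
  obtain ⟨g, hg, hmax⟩ := hFc.exists_isMaxOn ⟨0, hF0⟩
    (f := fun t => τ * t) (by fun_prop)
  have hg0 : 0 ≤ τ * g := by simpa using hmax hF0
  have hga : |τ * g| ≤ a := by
    have := A.b0 _ hg
    simp [X] at this
    rw [abs_mul]
    have ht : |τ| = 1 := by
      have : |τ| * |τ| = 1 := by rw [← abs_mul, hτ, abs_one]
      nlinarith [abs_nonneg τ]
    rwa [ht, one_mul]
  have hz : X (g + τ * ε) ∉ K := by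
    intro hz
    have h1 : τ * (g + τ * ε) ≤ τ * g := hmax hz
    have : τ * (g + τ * ε) = τ * g + (τ * τ) * ε := by ring
    rw [this, hτ] at h1
    linarith
  obtain ⟨f, w, hfK, hfz⟩ := geometric_hahn_banach_closed_point hK.1 hK.2.1.isClosed hz
  set n : E3 := (InnerProductSpace.toDual ℝ E3).symm f with hn
  have hnf : ∀ y, f y = n 0 * y 0 + n 1 * y 1 + n 2 * y 2 := by
    intro y
    rw [← e3_inner]
    exact (InnerProductSpace.toDual_symm_apply).symm
  have hlt : ∀ y ∈ K, n 0 * y 0 + n 1 * y 1 + n 2 * y 2 <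
      n 0 * (g + τ * ε) + n 1 * (β * b) + n 2 * (α * R + β * q2) := by
    intro y hy
    have h1 := (hfK y hy).trans hfz
    rw [hnf, hnf] at h1
    simpa [X] using h1
  set k : ℝ := n 0 * τ with hk
  have hk0 : 0 < k := by
    have h1 := hlt _ hg
    simp [X] at h1
    have : 0 < k * ε := by rw [hk]; linarith
    exact pos_of_mul_pos_left this hε.le
  have hkτ : k * τ = n 0 := by rw [hk, mul_assoc, hτ, mul_one]
  set v1 := -(n 1) / k with hv1
  set v2 := -(n 2) / k with hv2
  have e1 : n 1 = -(k * v1) := by rw [hv1]; field_simp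
  have e2 : n 2 = -(k * v2) := by rw [hv2]; field_simp
  set c := τ * g + ε - v1 * (β * b) - v2 * (α * R + β * q2) with hc
  have hs : ∀ y ∈ K, τ * y 0 ≤ c + v1 * y 1 + v2 * y 2 := by
    intro y hy
    have h1 := hlt y hy
    rw [← hkτ, e1, e2] at h1
    have h2 : k * (τ * y 0 - v1 * y 1 - v2 * y 2) < k * c := by
      have : k * c = k * τ * g + k * ε - k * v1 * (β * b) - k * v2 * (α * R + β * q2) := by
        rw [hc]; ring
      rw [this]
      have e3 : k * τ * (g + τ * ε) = k * τ * g + k * (τ * τ) * ε := by ring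
      rw [e3, hτ] at h1
      linarith
    have := lt_of_mul_lt_mul_left h2 hk0.le
    linarith
  have s0 := hs 0 h0
  have sp := hs _ A.p
  have sq := hs _ A.q
  simp at s0 sp sq
  have hx : |τ * g + ε| ≤ 2 * a := by
    rw [abs_le] at hga ⊢
    constructor <;> linarith
  have key := flat_arith (h := c) (x := τ * g + ε) (P := -v2 * R) (Q := -v1 * b - v2 * q2) (α := α)
    (β := β) hx hα hβ (by linarith) s0 (by linarith) (by linarith) (by rw [hc]; ring)
  have hP := key.1
  have hQ := key.2
  have hvR : |v2| * R ≤ 14 * a := by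
    rw [abs_mul, abs_neg, abs_of_pos hR0] at hP
    linarith
  refine ⟨g, c, v1, v2, hg, hs, by rw [hc]; ring, s0, ?_, hg0, ?_, hvR⟩
  · have h1 : τ * g + ε = c + β * (v1 * b + v2 * q2) + α * (v2 * R) := by rw [hc]; ring
    have h2 : -(β * c) ≤ β * (v1 * b + v2 * q2) := by
      have : β * (-c) ≤ β * (v1 * b + v2 * q2) :=
        mul_le_mul_of_nonneg_left (by linarith) (by linarith)
      linarith
    have h3 : -(α * c) ≤ α * (v2 * R) := by
      have : α * (-c) ≤ α * (v2 * R) :=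
        mul_le_mul_of_nonneg_left (by linarith) (by linarith)
      linarith
    nlinarith
  · have h1 : |v2 * q2| ≤ 14 * a := by
      rw [abs_mul]
      exact (mul_le_mul_of_nonneg_left A.hq2 (abs_nonneg _)).trans hvR
    have h2 : |v1 * b| ≤ 28 * a := by
      rw [abs_le] at h1 hQ ⊢
      constructor <;> linarith
    rwa [abs_mul, abs_of_pos hb0] at h2

/-- `K` lies between two planes whose gap at the origin is at most `m`. -/
def Wedge (K : Set E3) (a b R m : ℝ) : Prop :=
  ∃ c c' v1 v2 w1 w2 : ℝ, 0 ≤ c ∧ 0 ≤ c' ∧ c + c' ≤ m ∧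
    (∀ y ∈ K, y 0 ≤ c + v1 * y 1 + v2 * y 2) ∧ (∀ y ∈ K, -(y 0) ≤ c' + w1 * y 1 + w2 * y 2) ∧
    |v1| * b ≤ 28 * a ∧ |v2| * R ≤ 14 * a ∧ |w1| * b ≤ 28 * a ∧ |w2| * R ≤ 14 * a

lemma flat_fiber {K : Set E3} (hK : IsConvexBody K) (h0 : (0 : E3) ∈ K) {a b R q2 r0 r1 r2 : ℝ}
    (A : Axes K a b R q2 r0 r1 r2) {α β m : ℝ} (hα : 1 / 4 ≤ α) (hα' : α ≤ 3 / 8)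
    (hβ : 1 / 4 ≤ β) (hβ' : β ≤ 3 / 8) (hm : 0 < m) (hno : ¬ Wedge K a b R m) :
    ENNReal.ofReal (m / 16) ≤ volume {t : ℝ | (!₂[t, β * b, α * R + β * q2] : E3) ∈ K ∧
      (8 / 7 : ℝ) • (!₂[t, β * b, α * R + β * q2] : E3) ∉ K} := by
  have ha0 := A.ha
  obtain ⟨ε, hε, hεa, hεm⟩ : ∃ ε : ℝ, 0 < ε ∧ ε ≤ a ∧ 32 * ε ≤ m := by
    refine ⟨min a (m / 32), by positivity, min_le_left _ _, ?_⟩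
    have := min_le_right a (m / 32)
    linarith
  obtain ⟨g, c, v1, v2, hg, hs, he, hc0, hc4, hg0, hb1, hb2⟩ :=
    flat_support hK h0 A hα hα' hβ hβ' hε hεa (τ := 1) (by norm_num)
  obtain ⟨g', c', w1, w2, hg', hs', he', hc0', hc4', hg0', hb1', hb2'⟩ :=
    flat_support hK h0 A hα hα' hβ hβ' hε hεa (τ := -1) (by norm_num)
  have hcc : m < c + c' := by
    by_contra hcon
    push Not at hcon
    refine hno ⟨c, c', v1, v2, w1, w2, hc0, hc0', hcon, ?_, ?_, hb1, hb2, hb1', hb2'⟩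
    · intro y hy; simpa using hs y hy
    · intro y hy; simpa using hs' y hy
  set L := g' - ε + c' / 8 with hL
  set U := g + ε - c / 8 with hU
  have hsub : Icc g' g \ Icc L U ⊆ {t : ℝ | (!₂[t, β * b, α * R + β * q2] : E3) ∈ K ∧
      (8 / 7 : ℝ) • (!₂[t, β * b, α * R + β * q2] : E3) ∉ K} := by
    rintro t ⟨ht, htn⟩
    refine ⟨?_, ?_⟩
    · rcases eq_or_lt_of_le (ht.1.trans ht.2) with h | h
      · have : t = g := le_antisymm ht.2 (h ▸ ht.1)
        rw [this]; exact hg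
      · have hd : 0 < g - g' := by linarith
        have hcx := hK.1
        have hcv := hcx hg' hg (a := (g - t) / (g - g')) (b := (t - g') / (g - g'))
          (div_nonneg (by linarith [ht.2]) hd.le) (div_nonneg (by linarith [ht.1]) hd.le)
          (by field_simp; ring)
        convert hcv using 1
        ext i
        fin_cases i
        · simp; field_simp; ring
        · simp; field_simp; ring
        · simp; field_simp; ring
    · intro hin
      apply htn
      have h1 := hs _ hin
      have h2 := hs' _ hin
      simp at h1 h2
      constructor
      · rw [hL]; linarith
      · rw [hU]; linarith
  have hLU : 0 ≤ U - L := by rw [hL, hU]; linarith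
  refine le_trans ?_ ((le_measure_sdiff).trans (measure_mono hsub))
  rw [Real.volume_Icc, Real.volume_Icc, ← ENNReal.ofReal_sub _ hLU]
  apply ENNReal.ofReal_le_ofReal
  rw [hL, hU]
  linarith

lemma flat_wedge {Λ δ ε m : ℝ} (hΛ : 0 < Λ) {K : Set E3} (G : Good Λ K) {a b R q2 r0 r1 r2 : ℝ}
    (A : Axes K a b R q2 r0 r1 r2) (hδ : 7 * a ≤ δ * R) (hε : (μH[2] (band δ)).toReal ≤ ε)
    (hm : 0 < m) (hmε : 1024 * Λ * ε < b * R * m) : Wedge K a b R m := by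
  by_contra hno
  have hK := G.body
  have hb0 := A.b_pos
  have hR0 := A.R_pos
  set S : Set E3 := {y | (y ∈ K ∧ (8 / 7 : ℝ) • y ∉ K) ∧ (1 / 4 ≤ y 1 / b ∧ y 1 / b ≤ 3 / 8) ∧
    (1 / 4 ≤ (y 2 - y 1 / b * q2) / R ∧ (y 2 - y 1 / b * q2) / R ≤ 3 / 8)} with hS
  have hmeas : MeasurableSet S := by
    have c1 : Continuous fun y : E3 => y 1 / b := by fun_prop
    have c2 : Continuous fun y : E3 => (y 2 - y 1 / b * q2) / R := by fun_prop
    refine MeasurableSet.inter (MeasurableSet.inter hK.2.1.measurableSet ?_) ?_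
    · exact (hK.2.1.measurableSet.preimage
        (by fun_prop : Continuous fun y : E3 => (8 / 7 : ℝ) • y).measurable).compl
    · exact MeasurableSet.inter (measurableSet_Icc.preimage c1.measurable)
        (measurableSet_Icc.preimage c2.measurable)
  have hSK : S ⊆ K := fun y hy => hy.1.1
  have hScone : S ⊆ coneOver (gaussPre K (band δ)) := by
    rintro y ⟨⟨hy, hy8⟩, ⟨h1, h2⟩, h3, h4⟩
    refine flat_band G A hδ hy hy8 h3 h4 h1 h2 ?_ ?_
    · field_simp
    · field_simp; ring
  have hf := vol_fubini S hmeas (body_fin hK hSK) !![1, 0, 0; 0, 0, b; 0, R, q2] (1 / 4) (3 / 8)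
    (m / 16) (by norm_num) (by positivity) (by
      intro α β h1 h2 h3 h4
      refine (flat_fiber hK G.zero A h1 h2 h3 h4 hm hno).trans (measure_mono ?_)
      intro t ht
      have e : (WithLp.toLp 2 ((!![1, 0, 0; 0, 0, b; 0, R, q2] : Matrix (Fin 3) (Fin 3) ℝ).mulVec
          ![t, α, β]) : E3) = !₂[t, β * b, α * R + β * q2] := by
        ext i
        fin_cases i <;> simp
      show _ ∈ S
      rw [e]
      refine ⟨ht, ?_, ?_⟩
      · simp
        rw [mul_div_assoc, div_self hb0.ne', mul_one]
        constructor <;> linarith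
      · simp
        rw [mul_div_assoc, div_self hb0.ne', mul_one, add_sub_cancel_right, mul_div_assoc,
          div_self hR0.ne', mul_one]
        constructor <;> linarith)
  have hle : (volume S).toReal ≤ Λ * ε := by
    refine (ENNReal.toReal_mono (body_fin hK (cone_subset hK G.zero _)) (measure_mono hScone)).trans ?_
    refine (G.up (band δ) (fun u hu => hu.1) (measurableSet_band δ)).trans ?_
    gcongr
  rw [Matrix.det_fin_three] at hf
  generalize (volume S).toReal = V at hf hle
  simp [abs_mul, abs_of_pos hb0, abs_of_pos hR0] at hf
  norm_num at hf
  nlinarith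
/-! ### Part 6: conclusion -/

lemma flat_polar (V1 V2 : ℝ) : ∃ N c s : ℝ, 0 ≤ N ∧ c ^ 2 + s ^ 2 = 1 ∧ V1 = N * c ∧ V2 = N * s ∧
    N ≤ |V1| + |V2| := by
  by_cases h : V1 ^ 2 + V2 ^ 2 = 0
  · have h1 : V1 = 0 := by nlinarith [sq_nonneg V1, sq_nonneg V2]
    have h2 : V2 = 0 := by nlinarith [sq_nonneg V1, sq_nonneg V2]
    exact ⟨0, 1, 0, le_rfl, by norm_num, by simp [h1], by simp [h2], by positivity⟩
  · have hp : 0 < V1 ^ 2 + V2 ^ 2 := lt_of_le_of_ne (by positivity) (Ne.symm h)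
    set N := Real.sqrt (V1 ^ 2 + V2 ^ 2) with hN
    have hN0 : 0 < N := Real.sqrt_pos.2 hp
    have hN2 : N ^ 2 = V1 ^ 2 + V2 ^ 2 := Real.sq_sqrt hp.le
    refine ⟨N, V1 / N, V2 / N, hN0.le, ?_, by field_simp, by field_simp, ?_⟩
    · rw [div_pow, div_pow, ← add_div, ← hN2, div_self (by positivity)]
    · rw [hN]
      apply Real.sqrt_le_iff.2
      refine ⟨by positivity, ?_⟩
      nlinarith [sq_abs V1, sq_abs V2, mul_nonneg (abs_nonneg V1) (abs_nonneg V2)]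

set_option maxHeartbeats 4000000 in
lemma flat_strip {Λ σ m : ℝ} (hΛ : 0 < Λ) (hσ0 : 0 < σ) (hσ : σ ≤ 1 / 2) {K : Set E3}
    (G : Good Λ K) {a b R q2 r0 r1 r2 : ℝ} (A : Axes K a b R q2 r0 r1 r2) (haσ : a ≤ σ * R)
    (hW : Wedge K a b R m) :
    2 * σ ≤ Λ * (4 * b * R * m + 20 * σ * R ^ 2 * m + 8400 * σ ^ 2 * R ^ 3 * (a / b)) := by
  have ha0 := A.ha
  have hb0 := A.b_pos
  have hR0 := A.R_pos
  have hbR := A.hbR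
  obtain ⟨d, d', v1, v2, w1, w2, hd, hd', hm, hs, hs', hv1, hv2, hw1, hw2⟩ := hW
  obtain ⟨N, c, s, hN0, hcs, hV1, hV2, hN⟩ := flat_polar (v1 + w1) (v2 + w2)
  have hNb : N ≤ 84 * (a / b) := by
    have h1 : |v1 + w1| * b ≤ 56 * a := by
      have := mul_le_mul_of_nonneg_right (abs_add_le v1 w1) hb0.le
      linarith
    have h2 : |v2 + w2| * b ≤ 28 * a := by
      have h3 := mul_le_mul_of_nonneg_right (abs_add_le v2 w2) hR0.le
      have h4 := mul_le_mul_of_nonneg_left hbR (abs_nonneg (v2 + w2))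
      linarith
    have h3 : N * b ≤ 84 * a := by
      have := mul_le_mul_of_nonneg_right hN hb0.le
      linarith
    rw [← mul_div_assoc, le_div_iff₀ hb0]
    exact h3
  set ω := strip c s σ with hω
  set C := coneOver (gaussPre K ω) with hC
  set S := 5 * σ * R with hS
  have hS0 : 0 < S := by positivity
  have hCK : C ⊆ K := cone_subset G.body G.zero ω
  have hCS : ∀ y ∈ C, c * y 1 + s * y 2 ≤ S := by
    rintro y ⟨Y, hY, t, ht, rfl⟩
    have hYK := gaussPre_subset G.body _ hY
    obtain ⟨hYf, u, hu, hn⟩ := hY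
    have hz := normal_le hn G.zero
    obtain ⟨hus, hu0, hu1, hu2⟩ := hu
    rw [mem_unitSphere] at hus
    simp at hz hu0
    set E := c * u 1 + s * u 2 with hE
    set F := -s * u 1 + c * u 2 with hF
    set e := c * Y 1 + s * Y 2 with he
    set f := -s * Y 1 + c * Y 2 with hf
    have id1 : E ^ 2 + F ^ 2 = u 1 ^ 2 + u 2 ^ 2 := by
      have : E ^ 2 + F ^ 2 = (c ^ 2 + s ^ 2) * (u 1 ^ 2 + u 2 ^ 2) := by rw [hE, hF]; ring
      rw [this, hcs, one_mul]
    have id2 : E * e + F * f = u 1 * Y 1 + u 2 * Y 2 := by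
      have : E * e + F * f = (c ^ 2 + s ^ 2) * (u 1 * Y 1 + u 2 * Y 2) := by
        rw [hE, hF, he, hf]; ring
      rw [this, hcs, one_mul]
    have hu0' := sq_le_sq' (abs_le.1 hu0).1 (abs_le.1 hu0).2
    have hF' := sq_le_sq' (abs_le.1 (hu1.trans hσ)).1 (abs_le.1 (hu1.trans hσ)).2
    have hE2 : E ≤ -(1 / 2) := by nlinarith
    have hc1 : |c| ≤ 1 := abs_le_of_sq_le_sq (by nlinarith [sq_nonneg s]) (by norm_num)
    have hs1 : |s| ≤ 1 := abs_le_of_sq_le_sq (by nlinarith [sq_nonneg c]) (by norm_num)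
    have y0 := A.b0 Y hYK
    have y1 := A.b1 Y hYK
    have y2 := A.b2 Y hYK
    have hfR : |f| ≤ 2 * R := by
      calc |f| ≤ |-s * Y 1| + |c * Y 2| := abs_add_le _ _
        _ = |s| * |Y 1| + |c| * |Y 2| := by rw [abs_mul, abs_mul, abs_neg]
        _ ≤ 1 * R + 1 * R := by
            gcongr
            exact y1.trans hbR
        _ = 2 * R := by ring
    have t1 : u 0 * Y 0 ≤ a / 2 := by
      refine (le_abs_self _).trans ?_
      rw [abs_mul]
      have := mul_le_mul hu0 y0 (abs_nonneg _) (by norm_num)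
      linarith
    have t2 : F * f ≤ 2 * σ * R := by
      refine (le_abs_self _).trans ?_
      rw [abs_mul]
      have := mul_le_mul hu1 hfR (abs_nonneg _) hσ0.le
      linarith
    have heS : e ≤ S := by
      by_contra hcon
      push Not at hcon
      have h1 : E * e ≤ -(1 / 2) * e := mul_le_mul_of_nonneg_right hE2 (by linarith)
      have h2 : (0 : ℝ) ≤ u 0 * Y 0 + (E * e + F * f) := by rw [id2]; linarith
      linarith
    have h3 : c * (t • Y) 1 + s * (t • Y) 2 = t * e := by simp [he]; ring
    rw [h3]
    nlinarith [ht.1, ht.2]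
  set A1 : Set E3 := {y | y ∈ C ∧ c * y 1 + s * y 2 ≤ 0} with hA1
  set A2 : Set E3 := {y | y ∈ C ∧ 0 ≤ c * y 1 + s * y 2} with hA2
  have f1 : volume A1 ≠ ∞ := body_fin G.body (fun y hy => hCK hy.1)
  have f2 : volume A2 ≠ ∞ := body_fin G.body (fun y hy => hCK hy.1)
  have hsub : C ⊆ A1 ∪ A2 := by
    intro y hy
    rcases le_total (c * y 1 + s * y 2) 0 with h | h
    · exact Or.inl ⟨hy, h⟩
    · exact Or.inr ⟨hy, h⟩
  have hle : (volume C).toReal ≤ (volume A1).toReal + (volume A2).toReal := by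
    rw [← ENNReal.toReal_add f1 f2]
    exact ENNReal.toReal_mono (ENNReal.add_ne_top.2 ⟨f1, f2⟩)
      ((measure_mono hsub).trans (measure_union_le _ _))
  have hrow : ∀ y ∈ K, -d' ≤ y 0 + w1 * y 1 + w2 * y 2 ∧
      y 0 + w1 * y 1 + w2 * y 2 ≤ d + N * (c * y 1 + s * y 2) := by
    intro y hy
    refine ⟨by linarith [hs' y hy], ?_⟩
    have h1 := hs y hy
    have h2 : N * (c * y 1 + s * y 2) = (v1 + w1) * y 1 + (v2 + w2) * y 2 := by
      rw [hV1, hV2]; ring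
    rw [h2]
    linarith
  have k1 : (volume A1).toReal ≤ 4 * b * R * m := by
    have h := vol_upper A1 !![1, w1, w2; 0, 1, 0; 0, 0, 1] (by simp [Matrix.det_fin_three])
      ![-d', -b, -R] ![d, b, R] (by intro i; fin_cases i <;> simp <;> linarith) (by
        rintro y ⟨hy, hye⟩ i
        have hyK := hCK hy
        have h1 := hrow y hyK
        have h2 : N * (c * y 1 + s * y 2) ≤ 0 := mul_nonpos_of_nonneg_of_nonpos hN0 hye
        fin_cases i
        · simp [Matrix.mulVec, dotProduct, Fin.sum_univ_three]
          constructor <;> linarith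
        · simpa [Matrix.mulVec, dotProduct, Fin.sum_univ_three] using abs_le.1 (A.b1 y hyK)
        · simpa [Matrix.mulVec, dotProduct, Fin.sum_univ_three] using abs_le.1 (A.b2 y hyK))
    generalize (volume A1).toReal = V at h ⊢
    simp at h
    have h2 : (d + d') * (4 * (b * R)) ≤ m * (4 * (b * R)) := by gcongr
    nlinarith
  have k2 : (volume A2).toReal ≤ (m + N * S) * S * (4 * R) := by
    have hNS : 0 ≤ N * S := by positivity
    have h := vol_upper A2 !![1, w1, w2; 0, c, s; 0, -s, c]
      (by simp [Matrix.det_fin_three]; linarith)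
      ![-d', 0, -(2 * R)] ![d + N * S, S, 2 * R]
      (by intro i; fin_cases i <;> simp <;> linarith) (by
        rintro y ⟨hy, hye⟩ i
        have hyK := hCK hy
        have h1 := hrow y hyK
        have h2 : N * (c * y 1 + s * y 2) ≤ N * S := mul_le_mul_of_nonneg_left (hCS y hy) hN0
        have hc1 : |c| ≤ 1 := abs_le_of_sq_le_sq (by nlinarith [sq_nonneg s]) (by norm_num)
        have hs1 : |s| ≤ 1 := abs_le_of_sq_le_sq (by nlinarith [sq_nonneg c]) (by norm_num)
        have y1 := A.b1 y hyK
        have y2 := A.b2 y hyK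
        have hfR : |-s * y 1 + c * y 2| ≤ 2 * R := by
          calc |-s * y 1 + c * y 2| ≤ |-s * y 1| + |c * y 2| := abs_add_le _ _
            _ = |s| * |y 1| + |c| * |y 2| := by rw [abs_mul, abs_mul, abs_neg]
            _ ≤ 1 * R + 1 * R := by
                gcongr
                exact y1.trans hbR
            _ = 2 * R := by ring
        have hfR' := abs_le.1 hfR
        have hyS := hCS y hy
        fin_cases i
        · simp [Matrix.mulVec, dotProduct, Fin.sum_univ_three]
          constructor <;> linarith
        · simp [Matrix.mulVec, dotProduct, Fin.sum_univ_three]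
          constructor <;> linarith
        · simp [Matrix.mulVec, dotProduct, Fin.sum_univ_three]
          constructor <;> linarith)
    generalize (volume A2).toReal = V at h ⊢
    simp at h
    refine h.trans ?_
    have e1 : 2 * R + 2 * R = 4 * R := by ring
    rw [e1]
    have e2 : d + N * S + d' ≤ m + N * S := by linarith
    exact mul_le_mul_of_nonneg_right (mul_le_mul_of_nonneg_right e2 hS0.le) (by positivity)
  have h1 := strip_lower G.fin hcs hσ0 hσ
  have h2 := G.low ω (fun u hu => hu.1) (measurableSet_strip _ _ _)
  refine (h1.trans h2).trans (mul_le_mul_of_nonneg_left ?_ hΛ.le)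
  refine hle.trans ?_
  have k3 : (m + N * S) * S * (4 * R) ≤ 20 * σ * R ^ 2 * m + 8400 * σ ^ 2 * R ^ 3 * (a / b) := by
    have e : (m + N * S) * S * (4 * R) = 20 * σ * R ^ 2 * m + 100 * σ ^ 2 * R ^ 3 * N := by
      rw [hS]; ring
    rw [e]
    have : 100 * σ ^ 2 * R ^ 3 * N ≤ 100 * σ ^ 2 * R ^ 3 * (84 * (a / b)) := by gcongr
    linarith
  linarith

lemma flat_case {Λ η : ℝ} (hΛ : 0 < Λ) (hη : 0 < η) (hfin : μH[2] unitSphere ≠ ∞) :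
    ∃ R₀ > 0, ∀ (K : Set E3) (a b R q2 r0 r1 r2 : ℝ), Good Λ K → Axes K a b R q2 r0 r1 r2 →
      η * R ≤ b → R ≤ R₀ := by
  set M := (μH[2] unitSphere).toReal with hM
  have hM1 : 1 ≤ M := sphere_ge_one hfin
  set B : ℝ := 27 * Λ * M with hB
  have hB0 : 0 < B := by positivity
  obtain ⟨σ, hσ0, hσ1, hσ2⟩ : ∃ σ : ℝ, 0 < σ ∧ σ ≤ 1 / 2 ∧ 16800 * B * Λ / η ^ 2 * σ ≤ 1 := by
    refine ⟨min (1 / 2) (1 / (16800 * B * Λ / η ^ 2)), by positivity, min_le_left _ _, ?_⟩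
    have := min_le_right (1 / 2) (1 / (16800 * B * Λ / η ^ 2))
    rw [le_div_iff₀ (by positivity)] at this
    linarith
  set D : ℝ := Λ * ((4 + 10 / η) * (2048 * Λ)) with hD
  have hD0 : 0 < D := by positivity
  set ε : ℝ := σ / (2 * D) with hε
  have hε0 : 0 < ε := by positivity
  have hDε : D * ε = σ / 2 := by rw [hε]; field_simp
  obtain ⟨δ, hδ, hδε⟩ := exists_band hfin hε0
  refine ⟨1 + 7 * B / (η * δ) + B / (η * σ), by positivity, ?_⟩
  intro K a b R q2 r0 r1 r2 G A hbη
  by_contra hcon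
  push Not at hcon
  have ha0 := A.ha
  have hb0 := A.b_pos
  have hR0 := A.R_pos
  have hAB : a * b * R ≤ B := G.abR_le A
  have t1 : 0 < 7 * B / (η * δ) := by positivity
  have t2 : 0 < B / (η * σ) := by positivity
  have hR1 : 1 < R := by linarith
  have ha2 : a * (η * R ^ 2) ≤ B := by
    have : a * R * (η * R) ≤ a * R * b := by gcongr
    linarith
  have haη : a * η ≤ B := by
    have h1 : a * η * 1 ≤ a * η * R ^ 2 := by gcongr; nlinarith
    linarith
  have hδR : 7 * a ≤ δ * R := by
    have h1 : 7 * B / (η * δ) < R := by linarith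
    rw [div_lt_iff₀ (by positivity)] at h1
    have : η * (7 * a) ≤ η * (δ * R) := by linarith
    exact le_of_mul_le_mul_left this hη
  have haσ : a ≤ σ * R := by
    have h1 : B / (η * σ) < R := by linarith
    rw [div_lt_iff₀ (by positivity)] at h1
    have : η * a ≤ η * (σ * R) := by linarith
    exact le_of_mul_le_mul_left this hη
  set m : ℝ := 2048 * Λ * ε / (b * R) with hm
  have hm0 : 0 < m := by positivity
  have hbRm : b * R * m = 2048 * Λ * ε := by rw [hm]; field_simp
  have hW := flat_wedge hΛ G A hδR hδε hm0
    (by rw [hbRm]; have : 0 < Λ * ε := by positivity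
        linarith)
  have key := flat_strip hΛ hσ0 hσ1 G A haσ hW
  have e1 : 20 * σ * R ^ 2 * m ≤ 10 / η * (b * R * m) := by
    have h1 : R ≤ b / η := by rw [le_div_iff₀ hη]; linarith
    calc 20 * σ * R ^ 2 * m = 20 * σ * R * R * m := by ring
      _ ≤ 20 * (1 / 2) * (b / η) * R * m := by gcongr
      _ = 10 / η * (b * R * m) := by field_simp; norm_num
  have e2 : 8400 * σ ^ 2 * R ^ 3 * (a / b) ≤ 8400 * σ ^ 2 * (B / η ^ 2) := by
    have h1 : R ^ 3 * (a / b) ≤ B / η ^ 2 := by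
      rw [le_div_iff₀ (by positivity), ← mul_div_assoc, div_mul_eq_mul_div, div_le_iff₀ hb0]
      have h2 : (η * R) ^ 2 ≤ b ^ 2 := by gcongr
      calc R ^ 3 * a * η ^ 2 = a * R * (η * R) ^ 2 := by ring
        _ ≤ a * R * b ^ 2 := by gcongr
        _ = a * b * R * b := by ring
        _ ≤ B * b := by gcongr
    calc 8400 * σ ^ 2 * R ^ 3 * (a / b) = 8400 * σ ^ 2 * (R ^ 3 * (a / b)) := by ring
      _ ≤ _ := by gcongr
  have e3 : Λ * (4 * b * R * m + 20 * σ * R ^ 2 * m + 8400 * σ ^ 2 * R ^ 3 * (a / b)) ≤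
      Λ * (4 * (b * R * m) + 10 / η * (b * R * m) + 8400 * σ ^ 2 * (B / η ^ 2)) := by
    apply mul_le_mul_of_nonneg_left _ hΛ.le
    linarith
  have e4 : Λ * (4 * (b * R * m) + 10 / η * (b * R * m) + 8400 * σ ^ 2 * (B / η ^ 2)) =
      D * ε + σ / 2 * (16800 * B * Λ / η ^ 2 * σ) := by
    rw [hbRm, hD]; ring
  have e5 : σ / 2 * (16800 * B * Λ / η ^ 2 * σ) ≤ σ / 2 * 1 := by gcongr
  linarith

theorem stmt1 (lam : ℝ) (hlam : 1 < lam) :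
    ∃ C > 0, ∀ f : E3 → ℝ, ∀ K : Set E3,
      (∀ u ∈ unitSphere, 1 / lam < f u ∧ f u < lam) →
      IsConvexBody K → 0 ∈ K → SolvesLMP K f →
      (∀ u ∈ unitSphere, |suppFn K u| ≤ C) ∧ K ⊆ Metric.closedBall 0 C := by
  have hΛ : 0 < 3 * lam := by linarith
  by_cases hfin : μH[2] unitSphere = ∞
  · refine ⟨1, one_pos, ?_⟩
    intro f K hf hK h0 hs
    exact absurd hfin (good_of_solves hlam hf hK h0 hs).fin
  obtain ⟨η, hη, hlong⟩ := long_case hΛ hfin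
  obtain ⟨C, hC, hflat⟩ := flat_case hΛ hη hfin
  refine ⟨C, hC, ?_⟩
  intro f K hf hK h0 hs
  have G := good_of_solves hlam hf hK h0 hs
  obtain ⟨T, a, b, R, q2, r0, r1, r2, A, hR⟩ := exists_axes G
  have G' := G.rotate T
  have hRC : R ≤ C := hflat _ a b R q2 r0 r1 r2 G' A (hlong _ a b R q2 r0 r1 r2 G' A)
  have hKC : ∀ y ∈ K, ‖y‖ ≤ C := fun y hy => (hR y hy).trans hRC
  refine ⟨?_, fun y hy => by rw [mem_closedBall_zero_iff]; exact hKC y hy⟩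
  intro u hu
  rw [unitSphere, mem_sphere_zero_iff_norm] at hu
  have hle : ∀ x ∈ (fun y => ⟪u, y⟫) '' K, x ≤ C := by
    rintro x ⟨y, hy, rfl⟩
    have := real_inner_le_norm u y
    rw [hu, one_mul] at this
    exact this.trans (hKC y hy)
  have h0m : (0 : ℝ) ∈ (fun y => ⟪u, y⟫) '' K := ⟨0, h0, by simp⟩
  have h1 : suppFn K u ≤ C := csSup_le ⟨0, h0m⟩ hle
  have h2 : 0 ≤ suppFn K u := le_csSup ⟨C, hle⟩ h0m
  rw [abs_of_nonneg h2]
  exact h1
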